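/- Consider the normalized ARS on the Heisenberg group G with orthonormal frame {X, Z, 𝒳}, where the derivation is D = [[0,b,0],[c,d,0],[0,f,d]] with c > 0 and d, f ≥ 0, and let P_{ε,ε'} = diag(ε, ε⁻¹ε', ε') in the basis (X,Y,Z) for ε, ε' ∈ {±1}. Then the group of isometries of this ARS is: (i) if d ≠ 0 and f ≠ 0, exactly the left translations by elements of Z_𝒳; (ii) if d ≠ 0 and f = 0, generated by those left translations and the identity-fixing isometries whose differential at e is P_{ε,1}, ε = ±1; (iii) if d = 0 and f ≠ 0, generated by those left translations and the identity-fixing isometries with differential P_{ε,ε}, ε = ±1; (iv) if d = f = 0, generated by those left translations and the identity-fixing isometries with differential P_{ε,ε'} for all ε, ε' = ±1. In particular, if b, d and f are all nonzero then Z_𝒳 = {e} and the group of isometries is reduced to the identity. -/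

import Mathlib

open Set ENNReal

noncomputable section

/-- The 3-dimensional Heisenberg group, identified in coordinates with `ℝ³`:
`(x,y,z)` corresponds to the unipotent matrix `[[1,x,z],[0,1,y],[0,0,1]]`. -/
abbrev Heis : Type := ℝ × ℝ × ℝ

/-- The group product of the Heisenberg group in coordinates. -/
def heisMul (p q : Heis) : Heis := (p.1 + q.1, p.2.1 + q.2.1, p.2.2 + q.2.2 + p.1 * q.2.1)

/-- The identity element. -/
def heisOne : Heis := (0, 0, 0)

/-- The group inverse. -/
def heisInv (p : Heis) : Heis := (-p.1, -p.2.1, -p.2.2 + p.1 * p.2.1)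

/-- The left translation by `g`. -/
def heisLT (g : Heis) : Heis → Heis := fun p => heisMul g p

/-- The left-invariant vector field `X`. -/
def heisX : Heis → Heis := fun _ => (1, 0, 0)

/-- The left-invariant vector field `Y`. -/
def heisY (p : Heis) : Heis := (0, 1, p.1)

/-- The left-invariant vector field `Z`. -/
def heisZ : Heis → Heis := fun _ => (0, 0, 1)

/-- The left-invariant vector field with coordinates `u = (u₁,u₂,u₃)` in the basis
`(X,Y,Z)` of the Lie algebra. -/
def heisLI (u : Heis) : Heis → Heis := fun p => u.1 • heisX p + u.2.1 • heisY p + u.2.2 • heisZ p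

/-- The Lie bracket of the Heisenberg Lie algebra in the basis `(X,Y,Z)`:
`[X,Y] = Z` and all the other brackets of basis elements vanish. -/
def heisBracket (u v : Heis) : Heis := (0, 0, u.1 * v.2.1 - v.1 * u.2.1)

/-- The data of an ARS on the Heisenberg group: two left-invariant vector fields
`B₁, B₂` (given by their coordinates in the basis `(X,Y,Z)`) and the linear vector
field associated to the derivation `D = [[a,b,0],[c,d,0],[e,f,a+d]]`. -/
structure HeisARS where
  B1 : Heis
  B2 : Heis
  a : ℝ
  b : ℝ
  c : ℝ
  d : ℝ
  e : ℝ
  f : ℝ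

/-- The linear vector field associated to the derivation `D = [[a,b,0],[c,d,0],[e,f,a+d]]`:
`𝒳(x,y,z) = (ax+by)∂/∂x + (cx+dy)∂/∂y + (ex+fy+(a+d)z+½cx²+½by²)∂/∂z`. -/
def HeisARS.lin (S : HeisARS) (p : Heis) : Heis :=
  (S.a * p.1 + S.b * p.2.1,
   S.c * p.1 + S.d * p.2.1,
   S.e * p.1 + S.f * p.2.1 + (S.a + S.d) * p.2.2 + S.c * p.1 ^ 2 / 2 + S.b * p.2.1 ^ 2 / 2)

/-- The first left-invariant vector field of the frame. -/
def HeisARS.V1 (S : HeisARS) : Heis → Heis := heisLI S.B1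

/-- The second left-invariant vector field of the frame. -/
def HeisARS.V2 (S : HeisARS) : Heis → Heis := heisLI S.B2

/-- The left-invariant distribution `Δ = span{B₁, B₂}` (at the identity). -/
def HeisARS.Delta (S : HeisARS) : Submodule ℝ Heis := Submodule.span ℝ {S.B1, S.B2}

/-- The Lie bracket of two vector fields on `ℝ³`, in coordinates. -/
def vfBracketH (V W : Heis → Heis) : Heis → Heis := fun p =>
  fderiv ℝ W p (V p) - fderiv ℝ V p (W p)

/-- The Lie algebra of vector fields generated by a family `F` of vector fields. -/
inductive HeisLieGen (F : Set (Heis → Heis)) : (Heis → Heis) → Prop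
  | base {V : Heis → Heis} : V ∈ F → HeisLieGen F V
  | add {V W : Heis → Heis} : HeisLieGen F V → HeisLieGen F W → HeisLieGen F (V + W)
  | smul (c : ℝ) {V : Heis → Heis} : HeisLieGen F V → HeisLieGen F (c • V)
  | bracket {V W : Heis → Heis} : HeisLieGen F V → HeisLieGen F W → HeisLieGen F (vfBracketH V W)

/-- The conditions for the data to define an ARS: the frame `{𝒳, B₁, B₂}` has full
rank on a nonempty subset of `G` and satisfies the rank condition. -/
def HeisARS.IsARS (S : HeisARS) : Prop :=
  (∃ p : Heis, Submodule.span ℝ {S.lin p, S.V1 p, S.V2 p} = ⊤) ∧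
  ∀ p : Heis, Submodule.span ℝ
    {v : Heis | ∃ V : Heis → Heis, HeisLieGen {S.lin, S.V1, S.V2} V ∧ V p = v} = ⊤

/-- The almost-Riemannian norm of a tangent vector `v` at `p`: the infimum of
`√(c² + u₁² + u₂²)` over the decompositions `v = c·𝒳(p) + u₁·B₁(p) + u₂·B₂(p)`,
infinite if there is no such decomposition. -/
def HeisARS.enorm (S : HeisARS) (p v : Heis) : ℝ≥0∞ :=
  sInf {r : ℝ≥0∞ | ∃ c u1 u2 : ℝ, c • S.lin p + u1 • S.V1 p + u2 • S.V2 p = v ∧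
    r = ENNReal.ofReal (Real.sqrt (c ^ 2 + u1 ^ 2 + u2 ^ 2))}

/-- A diffeomorphism of the Heisenberg group in coordinates: a smooth bijection of
`ℝ³` with smooth inverse. -/
structure IsHeisDiffeo (Φ : Heis → Heis) : Prop where
  bijective : Function.Bijective Φ
  smooth : ContDiff ℝ (⊤ : ℕ∞) Φ
  exists_smooth_inv : ∃ Ψ : Heis → Heis,
    Function.LeftInverse Ψ Φ ∧ Function.RightInverse Ψ Φ ∧ ContDiff ℝ (⊤ : ℕ∞) Ψ

/-- An isometry from the ARS `S` onto the ARS `S'` on the Heisenberg group. -/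
def IsHeisIsometry (S S' : HeisARS) (Φ : Heis → Heis) : Prop :=
  IsHeisDiffeo Φ ∧ ∀ p v : Heis, S'.enorm (Φ p) (fderiv ℝ Φ p v) = S.enorm p v

/-- Two ARSs on the Heisenberg group are isometric if there is an isometry from one
onto the other. -/
def HeisIsometric (S S' : HeisARS) : Prop := ∃ Φ, IsHeisIsometry S S' Φ

/-- The set `Z_𝒳` of singularities of the linear vector field of an ARS. -/
def HeisARS.linSingularities (S : HeisARS) : Set Heis := {g | S.lin g = 0}

/-- The coordinates of the basis vectors `X`, `Y`, `Z` of the Heisenberg Lie algebra. -/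
def XLv : Heis := (1, 0, 0)
def YLv : Heis := (0, 1, 0)
def ZLv : Heis := (0, 0, 1)

/-- The normalized ARS of the subalgebra case: orthonormal frame `{X, Z, 𝒳}` and
derivation `D = [[0,b,0],[c,d,0],[0,f,d]]`. -/
def subalgNormal (b c d f : ℝ) : HeisARS := ⟨XLv, ZLv, 0, b, c, d, 0, f⟩

theorem eqOn_of_hasDerivAt_of_contDiffAt {F : Type*} [NormedAddCommGroup F] [NormedSpace ℝ F]
    {V : F → F} {I : Set ℝ} (hI : IsOpen I) (hIc : IsPreconnected I) {f g : ℝ → F}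
    (hV : ∀ t ∈ I, ContDiffAt ℝ 1 V (f t))
    (hf : ∀ t ∈ I, HasDerivAt f (V (f t)) t) (hg : ∀ t ∈ I, HasDerivAt g (V (g t)) t)
    {t₀ : ℝ} (ht₀ : t₀ ∈ I) (h₀ : f t₀ = g t₀) : EqOn f g I := by
  have key : ∀ t ∈ I, f t = g t → f =ᶠ[nhds t] g := by
    intro t ht h
    obtain ⟨K, s, hs, hK⟩ := (hV t ht).exists_lipschitzOnWith
    refine ODE_solution_unique_of_eventually (v := fun _ => V) (s := fun _ => s) (K := K)
      (Filter.Eventually.of_forall fun _ => hK) ?_ ?_ h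
    · filter_upwards [hI.mem_nhds ht, (hf t ht).continuousAt hs] with r hr hr'
      exact ⟨hf r hr, hr'⟩
    · filter_upwards [hI.mem_nhds ht, (hg t ht).continuousAt (h ▸ hs)] with r hr hr'
      exact ⟨hg r hr, hr'⟩
  have hsub : I ⊆ {t | f =ᶠ[nhds t] g} := by
    refine hIc.subset_of_closure_inter_subset isOpen_setOfPred_eventually_nhds
      ⟨t₀, ht₀, key t₀ ht₀ h₀⟩ ?_
    rintro t ⟨htc, ht⟩
    refine key t ht ?_
    by_contra hne
    have h1 : ∀ᶠ r in nhds t, f r ≠ g r :=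
      
      (((hf t ht).continuousAt).ne_iff_eventually_ne (hg t ht).continuousAt).1 hne
    obtain ⟨r, hr1, hr2⟩ := mem_closure_iff_nhds.1 htc _ h1
    exact hr1 hr2.eq_of_nhds
  exact fun t ht => (hsub ht).eq_of_nhds

theorem eq_self_along_integralCurve {E : Type*} [NormedAddCommGroup E] [NormedSpace ℝ E]
    {V F : E → E} (hV : ContDiff ℝ 2 V) (hF : ContDiff ℝ 2 F)
    (hFV : ∀ z, fderiv ℝ F z (V z) = V (F z)) {γ : ℝ → E}
    (hγ : ∀ t, HasDerivAt γ (V (γ t)) t) (h₀ : F (γ 0) = γ 0)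
    (h₁ : fderiv ℝ F (γ 0) = ContinuousLinearMap.id ℝ E) (t : ℝ) :
    F (γ t) = γ t ∧ fderiv ℝ F (γ t) = ContinuousLinearMap.id ℝ E := by
  have hVd : Differentiable ℝ V := hV.differentiable (by norm_num)
  have hFd : Differentiable ℝ F := hF.differentiable (by norm_num)
  have hF1 : ContDiff ℝ 1 (fderiv ℝ F) := hF.fderiv_right (by norm_num)
  have hV1 : ContDiff ℝ 1 (fderiv ℝ V) := hV.fderiv_right (by norm_num)
  have hFd1 : Differentiable ℝ (fderiv ℝ F) := hF1.differentiable (by norm_num)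
  have hsymm : ∀ z u v, fderiv ℝ (fderiv ℝ F) z u v = fderiv ℝ (fderiv ℝ F) z v u := fun z =>
    second_derivative_symmetric (fun y => (hFd y).hasFDerivAt) (hFd1 z).hasFDerivAt
  have hdiff : ∀ z v, fderiv ℝ (fderiv ℝ F) z (V z) v =
      fderiv ℝ V (F z) (fderiv ℝ F z v) - fderiv ℝ F z (fderiv ℝ V z v) := by
    intro z v
    have e1 := (hFd1 z).hasFDerivAt.clm_apply (hVd z).hasFDerivAt
    have e2 := (hVd (F z)).hasFDerivAt.comp z (hFd z).hasFDerivAt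
    have e3 : (fun z => fderiv ℝ F z (V z)) = V ∘ F := funext hFV
    rw [e3] at e1
    have e4 := DFunLike.congr_fun (e1.unique e2) v
    simp at e4
    rw [hsymm, ← e4]; abel
  let W : E × E × (E →L[ℝ] E) → E × E × (E →L[ℝ] E) := fun p =>
    (V p.1, V p.2.1, (fderiv ℝ V p.2.1).comp p.2.2 - p.2.2.comp (fderiv ℝ V p.1))
  have hW : ContDiff ℝ 1 W := by
    have a1 : ContDiff ℝ 1 V := hV.of_le (by norm_num)
    refine (a1.comp contDiff_fst).prodMk ((a1.comp (contDiff_fst.comp contDiff_snd)).prodMk ?_)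
    refine ContDiff.sub ?_ ?_
    · exact (hV1.comp (contDiff_fst.comp contDiff_snd)).clm_comp (contDiff_snd.comp contDiff_snd)
    · exact (contDiff_snd.comp contDiff_snd).clm_comp (hV1.comp contDiff_fst)
  have := eqOn_of_hasDerivAt_of_contDiffAt (V := W) isOpen_univ isPreconnected_univ
    (f := fun t => (γ t, γ t, ContinuousLinearMap.id ℝ E))
    (g := fun t => (γ t, F (γ t), fderiv ℝ F (γ t))) (t₀ := 0)
    (fun t _ => hW.contDiffAt) ?_ ?_ (mem_univ _) ?_ (mem_univ t)
  · simp only [Prod.mk.injEq] at this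
    exact ⟨this.2.1.symm, this.2.2.symm⟩
  · intro t _
    have e3 : HasDerivAt (fun _ : ℝ => ContinuousLinearMap.id ℝ E) 0 t := hasDerivAt_const t _
    exact ((hγ t).prodMk ((hγ t).prodMk e3)).congr_deriv (by simp [W])
  · intro t _
    have e1 := (hFd (γ t)).hasFDerivAt.comp_hasDerivAt t (hγ t)
    have e2 := (hFd1 (γ t)).hasFDerivAt.comp_hasDerivAt t (hγ t)
    refine ((hγ t).prodMk (e1.prodMk e2)).congr_deriv ?_
    simp only [W, hFV, Prod.mk.injEq, true_and]
    ext v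
    simp [hdiff]
  · simp [h₀, h₁]

/-- A map satisfying the second order equation of an affine map for a connection `Γ` near a
segment, and agreeing with the identity to first order at one end, fixes the segment. -/
theorem eq_self_along_segment {E : Type*} [NormedAddCommGroup E] [NormedSpace ℝ E]
    {F : E → E} (hF : ContDiff ℝ 2 F) {Γ : E → E →L[ℝ] E →L[ℝ] E} {U : Set E} (hU : IsOpen U)
    (hUc : Convex ℝ U)
    (hΓ : ∀ q ∈ U, ContDiffAt ℝ 1 Γ q)
    (hFΓ : ∀ q ∈ U, ∀ u v, fderiv ℝ (fderiv ℝ F) q u v =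
      fderiv ℝ F q (Γ q u v) - Γ (F q) (fderiv ℝ F q u) (fderiv ℝ F q v))
    {q₀ : E} (hq₀ : q₀ ∈ U) (h₀ : F q₀ = q₀)
    (h₁ : fderiv ℝ F q₀ = ContinuousLinearMap.id ℝ E) {q : E} (hq : q ∈ U) : F q = q := by
  have hFd : Differentiable ℝ F := hF.differentiable (by norm_num)
  have hF1 : ContDiff ℝ 1 (fderiv ℝ F) := hF.fderiv_right (by norm_num)
  have hFd1 : Differentiable ℝ (fderiv ℝ F) := hF1.differentiable (by norm_num)
  let v := q - q₀
  let I : Set ℝ := AffineMap.lineMap q₀ q ⁻¹' U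
  have hI : IsOpen I := hU.preimage AffineMap.lineMap_continuous
  have hIc : IsPreconnected I := (hUc.affine_preimage _).isPreconnected
  let γ : ℝ → E := fun t => AffineMap.lineMap q₀ q t
  have hγ : ∀ t, HasDerivAt γ v t := fun t => AffineMap.hasDerivAt_lineMap
  let W : E × E × (E →L[ℝ] E) → E × E × (E →L[ℝ] E) := fun p =>
    (v, p.2.2 v, p.2.2.comp (Γ p.1 v) - (Γ p.2.1 (p.2.2 v)).comp p.2.2)
  have hW : ∀ p : E × E × (E →L[ℝ] E), p.1 ∈ U → p.2.1 ∈ U → ContDiffAt ℝ 1 W p := by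
    intro p hp1 hp2
    have c1 : ContDiffAt ℝ 1 (fun p : E × E × (E →L[ℝ] E) => p.1) p := contDiffAt_fst
    have c2 : ContDiffAt ℝ 1 (fun p : E × E × (E →L[ℝ] E) => p.2.1) p :=
      contDiffAt_fst.comp p contDiffAt_snd
    have c3 : ContDiffAt ℝ 1 (fun p : E × E × (E →L[ℝ] E) => p.2.2) p :=
      contDiffAt_snd.comp p contDiffAt_snd
    have c4 : ContDiffAt ℝ 1 (fun p : E × E × (E →L[ℝ] E) => p.2.2 v) p :=
      c3.clm_apply contDiffAt_const
    refine contDiffAt_const.prodMk (c4.prodMk (ContDiffAt.sub ?_ ?_))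
    · exact c3.clm_comp (((hΓ _ hp1).comp p c1).clm_apply contDiffAt_const)
    · exact (((hΓ _ hp2).comp p c2).clm_apply c4).clm_comp c3
  have h0I : (0 : ℝ) ∈ I := by simpa [I] using hq₀
  have h1I : (1 : ℝ) ∈ I := by simpa [I] using hq
  have := eqOn_of_hasDerivAt_of_contDiffAt (V := W) hI hIc
    (f := fun t => (γ t, γ t, ContinuousLinearMap.id ℝ E))
    (g := fun t => (γ t, F (γ t), fderiv ℝ F (γ t))) (t₀ := 0)
    (fun t ht => hW _ ht ht) ?_ ?_ h0I ?_ h1I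
  · simp only [Prod.mk.injEq] at this
    simpa [γ] using this.2.1.symm
  · intro t _
    have e3 : HasDerivAt (fun _ : ℝ => ContinuousLinearMap.id ℝ E) 0 t := hasDerivAt_const t _
    exact ((hγ t).prodMk ((hγ t).prodMk e3)).congr_deriv (by simp [W])
  · intro t ht
    have e1 := (hFd (γ t)).hasFDerivAt.comp_hasDerivAt t (hγ t)
    have e2 := (hFd1 (γ t)).hasFDerivAt.comp_hasDerivAt t (hγ t)
    refine ((hγ t).prodMk (e1.prodMk e2)).congr_deriv ?_
    simp only [W, Prod.mk.injEq, true_and]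
    ext u
    simp [hFΓ _ (show γ t ∈ U from ht)]
  · simp [γ, h₀, h₁]

/-- The linear vector field `𝒳` of the normalized structure, in coordinates. -/
def subalgLin (b c d f : ℝ) (p : Heis) : Heis :=
  (b * p.2.1, c * p.1 + d * p.2.1, f * p.2.1 + d * p.2.2 + c * p.1 ^ 2 / 2 + b * p.2.1 ^ 2 / 2)

/-- The squared norm of a tangent vector at a regular point. -/
def subalgNormSq (b c d f : ℝ) (p v : Heis) : ℝ :=
  (v.2.1 / (c * p.1 + d * p.2.1)) ^ 2 +
  (v.1 - (subalgLin b c d f p).1 * (v.2.1 / (c * p.1 + d * p.2.1))) ^ 2 +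
  (v.2.2 - (subalgLin b c d f p).2.2 * (v.2.1 / (c * p.1 + d * p.2.1))) ^ 2

theorem lin_subalgNormal (b c d f : ℝ) : (subalgNormal b c d f).lin = subalgLin b c d f := by
  ext p <;> simp [HeisARS.lin, subalgNormal, subalgLin]

theorem V1_subalgNormal (b c d f : ℝ) (p : Heis) : (subalgNormal b c d f).V1 p = (1, 0, 0) := by
  simp [HeisARS.V1, heisLI, subalgNormal, heisX, heisY, heisZ, XLv]

theorem V2_subalgNormal (b c d f : ℝ) (p : Heis) : (subalgNormal b c d f).V2 p = (0, 0, 1) := by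
  simp [HeisARS.V2, heisLI, subalgNormal, heisX, heisY, heisZ, ZLv]

theorem enorm_subalgNormal (b c d f : ℝ) (p v : Heis) : (subalgNormal b c d f).enorm p v =
    sInf {r : ℝ≥0∞ | ∃ k u₁ u₂ : ℝ,
      k • subalgLin b c d f p + u₁ • ((1, 0, 0) : Heis) + u₂ • ((0, 0, 1) : Heis) = v ∧
      r = ENNReal.ofReal (Real.sqrt (k ^ 2 + u₁ ^ 2 + u₂ ^ 2))} := by
  simp only [HeisARS.enorm, lin_subalgNormal, V1_subalgNormal, V2_subalgNormal]

theorem enorm_of_ne_zero {b c d f : ℝ} {p : Heis} (hp : c * p.1 + d * p.2.1 ≠ 0) (v : Heis) :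
    (subalgNormal b c d f).enorm p v =
      ENNReal.ofReal (Real.sqrt (subalgNormSq b c d f p v)) := by
  rw [enorm_subalgNormal]
  refine Eq.trans (congrArg sInf ?_) sInf_singleton
  ext r
  simp only [mem_ofPred_eq, mem_singleton_iff]
  constructor
  · rintro ⟨k, u₁, u₂, rfl, rfl⟩
    have hk : k * (c * p.1 + d * p.2.1) / (c * p.1 + d * p.2.1) = k := by field_simp
    rw [subalgNormSq]
    simp only [subalgLin, Prod.fst_add, Prod.snd_add, Prod.smul_fst, Prod.smul_snd, smul_eq_mul,
      mul_zero, add_zero, mul_one, hk]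
    ring_nf
  · rintro rfl
    refine ⟨v.2.1 / (c * p.1 + d * p.2.1),
      v.1 - (subalgLin b c d f p).1 * (v.2.1 / (c * p.1 + d * p.2.1)),
      v.2.2 - (subalgLin b c d f p).2.2 * (v.2.1 / (c * p.1 + d * p.2.1)), ?_, rfl⟩
    ext
    · simp [subalgLin]; ring
    · simp [subalgLin]; field_simp
    · simp [subalgLin]; ring

theorem enorm_eq_top {b c d f : ℝ} {p v : Heis} (hp : c * p.1 + d * p.2.1 = 0)
    (hv : v.2.1 ≠ 0) : (subalgNormal b c d f).enorm p v = ⊤ := by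
  rw [enorm_subalgNormal]
  refine Eq.trans (congrArg sInf ?_) sInf_empty
  ext r
  simp only [mem_ofPred_eq, mem_empty_iff_false, iff_false]
  rintro ⟨k, u₁, u₂, rfl, -⟩
  simp [subalgLin, hp] at hv

theorem subalgNormSq_nonneg (b c d f : ℝ) (p v : Heis) : 0 ≤ subalgNormSq b c d f p v := by
  unfold subalgNormSq; positivity

/-! ### Left translations and composition -/

theorem IsHeisIsometry.comp {S : HeisARS} {Φ Ψ : Heis → Heis} (hΦ : IsHeisIsometry S S Φ)
    (hΨ : IsHeisIsometry S S Ψ) : IsHeisIsometry S S (Φ ∘ Ψ) := by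
  obtain ⟨⟨b1, s1, i1, l1, r1, t1⟩, n1⟩ := hΦ
  obtain ⟨⟨b2, s2, i2, l2, r2, t2⟩, n2⟩ := hΨ
  refine ⟨⟨b1.comp b2, s1.comp s2, i2 ∘ i1, l1.comp l2, r1.comp r2, t2.comp t1⟩, fun p v => ?_⟩
  rw [fderiv_comp p (s1.differentiable (by simp) _) (s2.differentiable (by simp) _)]
  simp [n1, n2]

theorem heisLT_heisInv (g p : Heis) : heisLT g (heisLT (heisInv g) p) = p := by
  ext <;> simp [heisLT, heisMul, heisInv]; ring

theorem heisLT_heisInv' (g p : Heis) : heisLT (heisInv g) (heisLT g p) = p := by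
  ext <;> simp [heisLT, heisMul, heisInv]; ring

theorem contDiff_heisLT (g : Heis) {n : WithTop ℕ∞} : ContDiff ℝ n (heisLT g) := by
  unfold heisLT heisMul; fun_prop

theorem hasFDerivAt_heisLT (g p : Heis) : HasFDerivAt (heisLT g)
    ((ContinuousLinearMap.fst ℝ ℝ (ℝ × ℝ)).prod
      (((ContinuousLinearMap.fst ℝ ℝ ℝ).comp (ContinuousLinearMap.snd ℝ ℝ (ℝ × ℝ))).prod
      ((ContinuousLinearMap.snd ℝ ℝ ℝ).comp (ContinuousLinearMap.snd ℝ ℝ (ℝ × ℝ)) +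
        g.1 • (ContinuousLinearMap.fst ℝ ℝ ℝ).comp (ContinuousLinearMap.snd ℝ ℝ (ℝ × ℝ))))) p := by
  have h1 : HasFDerivAt (fun p : Heis => p.1) (ContinuousLinearMap.fst ℝ ℝ (ℝ × ℝ)) p :=
    hasFDerivAt_fst
  have h2 : HasFDerivAt (fun p : Heis => p.2.1)
    ((ContinuousLinearMap.fst ℝ ℝ ℝ).comp (ContinuousLinearMap.snd ℝ ℝ (ℝ × ℝ))) p :=
    ((ContinuousLinearMap.fst ℝ ℝ ℝ).comp (ContinuousLinearMap.snd ℝ ℝ (ℝ × ℝ))).hasFDerivAt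
  have h3 : HasFDerivAt (fun p : Heis => p.2.2)
    ((ContinuousLinearMap.snd ℝ ℝ ℝ).comp (ContinuousLinearMap.snd ℝ ℝ (ℝ × ℝ))) p :=
    ((ContinuousLinearMap.snd ℝ ℝ ℝ).comp (ContinuousLinearMap.snd ℝ ℝ (ℝ × ℝ))).hasFDerivAt
  exact (h1.const_add g.1).prodMk ((h2.const_add g.2.1).prodMk
    ((h3.const_add g.2.2).add (h2.const_mul g.1)))

theorem fderiv_heisLT (g p v : Heis) :
    fderiv ℝ (heisLT g) p v = (v.1, v.2.1, v.2.2 + g.1 * v.2.1) := by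
  rw [(hasFDerivAt_heisLT g p).fderiv]; simp

theorem isHeisDiffeo_heisLT (g : Heis) : IsHeisDiffeo (heisLT g) :=
  ⟨⟨Function.LeftInverse.injective (heisLT_heisInv' g),
    Function.RightInverse.surjective (heisLT_heisInv g)⟩, contDiff_heisLT g,
    heisLT (heisInv g), heisLT_heisInv' g, heisLT_heisInv g, contDiff_heisLT _⟩

theorem mem_linSingularities {b c d f : ℝ} {g : Heis} :
    g ∈ (subalgNormal b c d f).linSingularities ↔ b * g.2.1 = 0 ∧ c * g.1 + d * g.2.1 = 0 ∧
      f * g.2.1 + d * g.2.2 + c * g.1 ^ 2 / 2 = 0 := by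
  have : ∀ x : ℝ, b * x = 0 → b * x ^ 2 / 2 = 0 := fun x hx => by
    linear_combination x * hx / 2
  simp only [HeisARS.linSingularities, lin_subalgNormal, subalgLin, mem_ofPred_eq, Prod.ext_iff,
    Prod.fst_zero, Prod.snd_zero]
  constructor
  · rintro ⟨h1, h2, h3⟩
    exact ⟨h1, h2, by linarith [this _ h1]⟩
  · rintro ⟨h1, h2, h3⟩
    exact ⟨h1, h2, by linarith [this _ h1]⟩

theorem heisInv_mem_linSingularities {b c d f : ℝ} {g : Heis}
    (hg : g ∈ (subalgNormal b c d f).linSingularities) :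
    heisInv g ∈ (subalgNormal b c d f).linSingularities := by
  rw [mem_linSingularities] at hg ⊢
  obtain ⟨h1, h2, h3⟩ := hg
  simp only [heisInv]
  refine ⟨by linear_combination -h1, by linear_combination -h2, ?_⟩
  linear_combination -h3 + g.1 * h2

theorem isHeisIsometry_heisLT {b c d f : ℝ} {g : Heis}
    (hg : g ∈ (subalgNormal b c d f).linSingularities) :
    IsHeisIsometry (subalgNormal b c d f) (subalgNormal b c d f) (heisLT g) := by
  refine ⟨isHeisDiffeo_heisLT g, fun p v => ?_⟩
  rw [mem_linSingularities] at hg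
  obtain ⟨h1, h2, h3⟩ := hg
  rw [fderiv_heisLT, enorm_subalgNormal, enorm_subalgNormal]
  congr 1
  ext r
  simp only [mem_ofPred_eq]
  refine exists_congr fun k => exists_congr fun u₁ => exists_congr fun u₂ =>
    and_congr_left fun _ => ?_
  have e1 : (subalgLin b c d f (heisLT g p)).1 = (subalgLin b c d f p).1 := by
    simp only [subalgLin, heisLT, heisMul]; linear_combination h1
  have e2 : (subalgLin b c d f (heisLT g p)).2.1 = (subalgLin b c d f p).2.1 := by
    simp only [subalgLin, heisLT, heisMul]; linear_combination h2
  have e3 : (subalgLin b c d f (heisLT g p)).2.2 =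
      (subalgLin b c d f p).2.2 + g.1 * (subalgLin b c d f p).2.1 := by
    simp only [subalgLin, heisLT, heisMul]
    linear_combination h3 + (g.2.1 / 2 + p.2.1) * h1
  simp only [Prod.ext_iff, Prod.fst_add, Prod.snd_add, Prod.smul_fst, Prod.smul_snd, e1, e2, e3,
    smul_eq_mul]
  constructor
  · rintro ⟨a1, a2, a3⟩
    exact ⟨a1, a2, by linear_combination a3 - g.1 * a2⟩
  · rintro ⟨a1, a2, a3⟩
    exact ⟨a1, a2, by linear_combination a3 + g.1 * a2⟩

theorem IsHeisDiffeo.fderiv_surjective {Φ : Heis → Heis} (hΦ : IsHeisDiffeo Φ) (q : Heis) :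
    Function.Surjective (fderiv ℝ Φ q) := by
  obtain ⟨-, s1, Ψ, l1, r1, t1⟩ := hΦ
  have h := fderiv_comp (𝕜 := ℝ) (Φ q) (g := Φ) (f := Ψ) (s1.differentiable (by simp) _)
    (t1.differentiable (by simp) _)
  rw [r1.comp_eq_id, l1 q, fderiv_id] at h
  intro v
  exact ⟨fderiv ℝ Ψ (Φ q) v, by simpa using (DFunLike.congr_fun h v).symm⟩

theorem IsHeisIsometry.regular_iff {b c d f : ℝ} {Φ : Heis → Heis}
    (hΦ : IsHeisIsometry (subalgNormal b c d f) (subalgNormal b c d f) Φ) (q : Heis) :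
    c * (Φ q).1 + d * (Φ q).2.1 = 0 ↔ c * q.1 + d * q.2.1 = 0 := by
  constructor
  · intro h
    by_contra h'
    obtain ⟨v, hv⟩ := hΦ.1.fderiv_surjective q (0, 1, 0)
    have := hΦ.2 q v
    rw [enorm_of_ne_zero h', hv, enorm_eq_top h (by simp)] at this
    exact ENNReal.ofReal_ne_top this.symm
  · intro h
    by_contra h'
    have := hΦ.2 q (0, 1, 0)
    rw [enorm_of_ne_zero h', enorm_eq_top h (by simp)] at this
    exact ENNReal.ofReal_ne_top this

theorem IsHeisIsometry.normSq_eq {b c d f : ℝ} {Φ : Heis → Heis}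
    (hΦ : IsHeisIsometry (subalgNormal b c d f) (subalgNormal b c d f) Φ) {q : Heis}
    (hq : c * q.1 + d * q.2.1 ≠ 0) (v : Heis) :
    subalgNormSq b c d f (Φ q) (fderiv ℝ Φ q v) = subalgNormSq b c d f q v := by
  have := hΦ.2 q v
  rw [enorm_of_ne_zero hq, enorm_of_ne_zero ((hΦ.regular_iff q).not.2 hq),
    ENNReal.ofReal_eq_ofReal_iff (Real.sqrt_nonneg _) (Real.sqrt_nonneg _),
    Real.sqrt_inj (subalgNormSq_nonneg ..) (subalgNormSq_nonneg ..)] at this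
  exact this

theorem exists_frame_eq {b c d f : ℝ} {p : Heis} (hp : c * p.1 + d * p.2.1 ≠ 0) (v : Heis) :
    ∃ k u₁ u₂ : ℝ,
      v = k • subalgLin b c d f p + u₁ • ((1, 0, 0) : Heis) + u₂ • ((0, 0, 1) : Heis) := by
  refine ⟨v.2.1 / (c * p.1 + d * p.2.1),
    v.1 - (subalgLin b c d f p).1 * (v.2.1 / (c * p.1 + d * p.2.1)),
    v.2.2 - (subalgLin b c d f p).2.2 * (v.2.1 / (c * p.1 + d * p.2.1)), ?_⟩
  ext
  · simp [subalgLin]; ring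
  · simp [subalgLin]; field_simp
  · simp [subalgLin]; ring

theorem subalgNormSq_frame {b c d f : ℝ} {p : Heis} (hp : c * p.1 + d * p.2.1 ≠ 0)
    (k u₁ u₂ : ℝ) :
    subalgNormSq b c d f p
      (k • subalgLin b c d f p + u₁ • ((1, 0, 0) : Heis) + u₂ • ((0, 0, 1) : Heis)) =
    k ^ 2 + u₁ ^ 2 + u₂ ^ 2 := by
  have hk : k * (c * p.1 + d * p.2.1) / (c * p.1 + d * p.2.1) = k := by field_simp
  rw [subalgNormSq]
  simp only [subalgLin, Prod.fst_add, Prod.snd_add, Prod.smul_fst, Prod.smul_snd, smul_eq_mul,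
    mul_zero, add_zero, mul_one, hk]
  ring

theorem mul_transpose_eq_one_of_isometry {M : Matrix (Fin 3) (Fin 3) ℝ}
    (h : ∀ u : Fin 3 → ℝ, ∑ i, (M.mulVec u i) ^ 2 = ∑ i, u i ^ 2) : M * M.transpose = 1 := by
  rw [mul_eq_one_comm]
  have h0 := h ![1, 0, 0]
  have h1 := h ![0, 1, 0]
  have h2 := h ![0, 0, 1]
  have h01 := h ![1, 1, 0]
  have h02 := h ![1, 0, 1]
  have h12 := h ![0, 1, 1]
  simp [Matrix.mulVec, dotProduct, Fin.sum_univ_three] at h0 h1 h2 h01 h02 h12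
  ext i j
  fin_cases i <;> fin_cases j <;>
    simp [Matrix.mul_apply, Fin.sum_univ_three] <;> linarith

theorem isOpen_regular (c d : ℝ) : IsOpen {q : Heis | c * q.1 + d * q.2.1 ≠ 0} :=
  isOpen_ne_fun (by fun_prop) (by fun_prop)

theorem dense_regular {c : ℝ} (hc : 0 < c) (d : ℝ) : Dense {q : Heis | c * q.1 + d * q.2.1 ≠ 0} := by
  intro q
  by_cases hq : c * q.1 + d * q.2.1 = 0
  swap
  · exact subset_closure hq
  have h1 : Filter.Tendsto (fun t : ℝ => ((q.1 + t, q.2) : Heis)) (nhdsWithin 0 {0}ᶜ) (nhds q) := by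
    have : ContinuousAt (fun t : ℝ => ((q.1 + t, q.2) : Heis)) 0 := by fun_prop
    have h := this.tendsto
    simp only [add_zero, Prod.mk.eta] at h
    exact h.mono_left nhdsWithin_le_nhds
  refine mem_closure_of_tendsto h1 ?_
  filter_upwards [self_mem_nhdsWithin] with t ht
  have : c * (q.1 + t) + d * q.2.1 = c * t := by linear_combination hq
  simpa [this] using ⟨hc.ne', ht⟩

theorem contDiff_subalgLin (b c d f : ℝ) {n : WithTop ℕ∞} : ContDiff ℝ n (subalgLin b c d f) := by
  unfold subalgLin; fun_prop

theorem IsHeisIsometry.cometric {b c d f : ℝ} (hc : 0 < c) {Φ : Heis → Heis}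
    (hΦ : IsHeisIsometry (subalgNormal b c d f) (subalgNormal b c d f) Φ) (q : Heis)
    (P : Heis →L[ℝ] ℝ) :
    P (fderiv ℝ Φ q (1, 0, 0)) • fderiv ℝ Φ q (1, 0, 0) +
      P (fderiv ℝ Φ q (0, 0, 1)) • fderiv ℝ Φ q (0, 0, 1) +
      P (fderiv ℝ Φ q (subalgLin b c d f q)) • fderiv ℝ Φ q (subalgLin b c d f q) =
    P (1, 0, 0) • ((1, 0, 0) : Heis) + P (0, 0, 1) • ((0, 0, 1) : Heis) +
      P (subalgLin b c d f (Φ q)) • subalgLin b c d f (Φ q) := by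
  have hΦc : Continuous Φ := hΦ.1.smooth.continuous
  have hl : Continuous (subalgLin b c d f) := (contDiff_subalgLin b c d f (n := 0)).continuous
  have hD : Continuous (fderiv ℝ Φ) := hΦ.1.smooth.continuous_fderiv (by simp)
  revert q
  rw [← funext_iff]
  refine Continuous.ext_on (dense_regular hc d) ?_ ?_ ?_
  · fun_prop
  · fun_prop
  intro q hq
  simp only [mem_ofPred_eq] at hq
  beta_reduce
  have hq' : c * (Φ q).1 + d * (Φ q).2.1 ≠ 0 := (hΦ.regular_iff q).not.2 hq
  set T := fderiv ℝ Φ q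
  obtain ⟨m00, m10, m20, h0⟩ := exists_frame_eq (b := b) (f := f) hq' (T (subalgLin b c d f q))
  obtain ⟨m01, m11, m21, h1⟩ := exists_frame_eq (b := b) (f := f) hq' (T (1, 0, 0))
  obtain ⟨m02, m12, m22, h2⟩ := exists_frame_eq (b := b) (f := f) hq' (T (0, 0, 1))
  have hM : ∀ u : Fin 3 → ℝ,
      ∑ i, ((!![m00, m01, m02; m10, m11, m12; m20, m21, m22]).mulVec u i) ^ 2 = ∑ i, u i ^ 2 := by
    intro u
    have := hΦ.normSq_eq hq
      (u 0 • subalgLin b c d f q + u 1 • ((1, 0, 0) : Heis) + u 2 • ((0, 0, 1) : Heis))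
    rw [subalgNormSq_frame hq, map_add, map_add, map_smul, map_smul, map_smul] at this
    change subalgNormSq b c d f (Φ q) (u 0 • T _ + u 1 • T _ + u 2 • T _) = _ at this
    rw [h0, h1, h2] at this
    have e := subalgNormSq_frame (b := b) (f := f) hq' (m00 * u 0 + m01 * u 1 + m02 * u 2)
      (m10 * u 0 + m11 * u 1 + m12 * u 2) (m20 * u 0 + m21 * u 1 + m22 * u 2)
    simp only [Matrix.mulVec, dotProduct, Fin.sum_univ_three, Matrix.of_apply, Matrix.cons_val]
    rw [← this, ← e]
    congr 1
    module
  have hO := mul_transpose_eq_one_of_isometry hM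
  have hO' := fun i j => congrFun (congrFun hO i) j
  have o00 := hO' 0 0
  have o01 := hO' 0 1
  have o02 := hO' 0 2
  have o11 := hO' 1 1
  have o12 := hO' 1 2
  have o22 := hO' 2 2
  simp [Matrix.mul_apply, Fin.sum_univ_three] at o00 o01 o02 o11 o12 o22
  rw [h0, h1, h2]
  generalize subalgLin b c d f (Φ q) = F
  simp only [map_add, map_smul, smul_eq_mul]
  generalize P (1, 0, 0) = p1
  generalize P (0, 0, 1) = p2
  generalize P F = p0
  have key : ∀ F x z : ℝ, (m01 * p0 + m11 * p1 + m21 * p2) * (m01 * F + m11 * x + m21 * z) +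
      (m02 * p0 + m12 * p1 + m22 * p2) * (m02 * F + m12 * x + m22 * z) +
      (m00 * p0 + m10 * p1 + m20 * p2) * (m00 * F + m10 * x + m20 * z) =
      p1 * x + p2 * z + p0 * F := by
    intro F x z
    linear_combination (p0 * F) * o00 + (p1 * x) * o11 + (p2 * z) * o22 +
      (p0 * x + p1 * F) * o01 + (p0 * z + p2 * F) * o02 + (p1 * z + p2 * x) * o12
  ext
  · simpa [mul_add] using key F.1 1 0
  · simpa [mul_add] using key F.2.1 0 0
  · simpa [mul_add] using key F.2.2 0 1

/-- The algebra of smooth real functions on the Heisenberg group. -/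
def heisSmooth : Subalgebra ℝ (Heis → ℝ) where
  carrier := {F | ContDiff ℝ (⊤ : ℕ∞) F}
  mul_mem' := fun h₁ h₂ => mem_ofPred.2 ((mem_ofPred.1 h₁).mul (mem_ofPred.1 h₂))
  add_mem' := fun h₁ h₂ => mem_ofPred.2 ((mem_ofPred.1 h₁).add (mem_ofPred.1 h₂))
  algebraMap_mem' := fun k => mem_ofPred.2 (contDiff_const (c := k))

namespace heisSmooth

theorem mem_iff {F : Heis → ℝ} : F ∈ heisSmooth ↔ ContDiff ℝ (⊤ : ℕ∞) F := mem_ofPred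

theorem contDiff (F : heisSmooth) : ContDiff ℝ (⊤ : ℕ∞) F.1 := mem_iff.1 F.2

theorem differentiable (F : heisSmooth) : Differentiable ℝ F.1 :=
  (heisSmooth.contDiff F).differentiable (by simp)

/-- Evaluation at a point. -/
def ev (p : Heis) : heisSmooth →ₐ[ℝ] ℝ := (Pi.evalAlgHom ℝ (fun _ : Heis => ℝ) p).comp (Subalgebra.val _)

theorem ext_ev {F G : heisSmooth} (h : ∀ p, ev p F = ev p G) : F = G :=
  Subtype.ext (funext h)

/-- The derivative in a constant direction, as a derivation of the algebra of smooth functions. -/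
def pd (v : Heis) : Derivation ℝ heisSmooth heisSmooth :=
  Derivation.mk'
    { toFun := fun F => ⟨fun p => fderiv ℝ F.1 p v,
        mem_iff.2 <| ((heisSmooth.contDiff F).fderiv_right (m := (⊤ : ℕ∞)) (by simp)).clm_apply contDiff_const⟩
      map_add' := fun F G => Subtype.ext <| funext fun p => by
        change fderiv ℝ (F.1 + G.1) p v = fderiv ℝ F.1 p v + fderiv ℝ G.1 p v
        rw [fderiv_add (heisSmooth.differentiable F p) (heisSmooth.differentiable G p)]; rfl
      map_smul' := fun k F => Subtype.ext <| funext fun p => by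
        change fderiv ℝ (k • F.1) p v = k • fderiv ℝ F.1 p v
        rw [fderiv_const_smul (heisSmooth.differentiable F p)]; rfl }
    fun F G => Subtype.ext <| funext fun p => by
      change fderiv ℝ (F.1 * G.1) p v = F.1 p * fderiv ℝ G.1 p v + G.1 p * fderiv ℝ F.1 p v
      rw [fderiv_mul (heisSmooth.differentiable F p) (heisSmooth.differentiable G p)]; rfl

theorem ev_pd (p v : Heis) (F : heisSmooth) : ev p (pd v F) = fderiv ℝ F.1 p v := rfl

theorem pd_comm (u v : Heis) (F : heisSmooth) : pd u (pd v F) = pd v (pd u F) := by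
  have hd : Differentiable ℝ (fderiv ℝ F.1) :=
    ((heisSmooth.contDiff F).fderiv_right (m := (⊤ : ℕ∞)) (by simp)).differentiable (by simp)
  have key : ∀ (p u v : Heis), ev p (pd u (pd v F)) = fderiv ℝ (fderiv ℝ F.1) p u v := by
    intro p u v
    change fderiv ℝ (fun q => fderiv ℝ F.1 q v) p u = _
    rw [((hd p).hasFDerivAt.clm_apply (hasFDerivAt_const v p)).fderiv]
    simp
  refine ext_ev fun p => ?_
  rw [key, key]
  exact second_derivative_symmetric (fun y => (heisSmooth.differentiable F y).hasFDerivAt)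
    (hd p).hasFDerivAt u v

/-- The partial derivatives. -/
abbrev Dx : Derivation ℝ heisSmooth heisSmooth := pd (1, 0, 0)
abbrev Dy : Derivation ℝ heisSmooth heisSmooth := pd (0, 1, 0)
abbrev Dz : Derivation ℝ heisSmooth heisSmooth := pd (0, 0, 1)

theorem Dy_Dx (F : heisSmooth) : Dy (Dx F) = Dx (Dy F) := pd_comm _ _ F
theorem Dz_Dx (F : heisSmooth) : Dz (Dx F) = Dx (Dz F) := pd_comm _ _ F
theorem Dz_Dy (F : heisSmooth) : Dz (Dy F) = Dy (Dz F) := pd_comm _ _ F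

theorem ev_pd_eq (p v : Heis) (F : heisSmooth) :
    ev p (pd v F) = v.1 * ev p (Dx F) + v.2.1 * ev p (Dy F) + v.2.2 * ev p (Dz F) := by
  simp only [ev_pd]
  have : v = v.1 • ((1, 0, 0) : Heis) + v.2.1 • ((0, 1, 0) : Heis) + v.2.2 • ((0, 0, 1) : Heis) := by
    ext <;> simp
  conv_lhs => rw [this]
  simp only [map_add, map_smul, smul_eq_mul]

theorem ev_pd_eq_zero_of_line {F : heisSmooth} {p v : Heis} {k : ℝ}
    (h : ∀ t : ℝ, ev (p + t • v) F = k) : ev p (pd v F) = 0 := by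
  have h1 : HasDerivAt (fun t : ℝ => F.1 (p + t • v)) (fderiv ℝ F.1 p v) 0 := by
    have e1 : HasDerivAt (fun t : ℝ => p + t • v) v 0 := by
      simpa using ((hasDerivAt_id (0 : ℝ)).smul_const v).const_add p
    have e2 : HasFDerivAt F.1 (fderiv ℝ F.1 p) (p + (0 : ℝ) • v) := by
      simpa using (heisSmooth.differentiable F p).hasFDerivAt
    exact e2.comp_hasDerivAt 0 e1
  have h2 : (fun t : ℝ => F.1 (p + t • v)) = fun _ => k := funext h
  rw [h2] at h1
  exact h1.unique (hasDerivAt_const _ _)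

/-- The coordinate functions. -/
def X₁ : heisSmooth := ⟨fun p => p.1, mem_iff.2 contDiff_fst⟩
def X₂ : heisSmooth := ⟨fun p => p.2.1, mem_iff.2 <| contDiff_fst.comp contDiff_snd⟩
def X₃ : heisSmooth := ⟨fun p => p.2.2, mem_iff.2 <| contDiff_snd.comp contDiff_snd⟩

@[simp] theorem ev_X₁ (p : Heis) : ev p X₁ = p.1 := rfl
@[simp] theorem ev_X₂ (p : Heis) : ev p X₂ = p.2.1 := rfl
@[simp] theorem ev_X₃ (p : Heis) : ev p X₃ = p.2.2 := rfl

theorem pd_X₁ (v : Heis) : pd v X₁ = algebraMap ℝ heisSmooth v.1 := by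
  refine ext_ev fun p => ?_
  rw [ev_pd, AlgHom.commutes]
  exact DFunLike.congr_fun (ContinuousLinearMap.fst ℝ ℝ (ℝ × ℝ)).fderiv v

theorem pd_X₂ (v : Heis) : pd v X₂ = algebraMap ℝ heisSmooth v.2.1 := by
  refine ext_ev fun p => ?_
  rw [ev_pd, AlgHom.commutes]
  exact DFunLike.congr_fun
    ((ContinuousLinearMap.fst ℝ ℝ ℝ).comp (ContinuousLinearMap.snd ℝ ℝ (ℝ × ℝ))).fderiv v

theorem pd_X₃ (v : Heis) : pd v X₃ = algebraMap ℝ heisSmooth v.2.2 := by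
  refine ext_ev fun p => ?_
  rw [ev_pd, AlgHom.commutes]
  exact DFunLike.congr_fun
    ((ContinuousLinearMap.snd ℝ ℝ ℝ).comp (ContinuousLinearMap.snd ℝ ℝ (ℝ × ℝ))).fderiv v

end heisSmooth

namespace heisSmooth

/-- The components of `𝒳` as smooth functions. -/
def linβ (b : ℝ) : heisSmooth := b • X₂
def linω (c d : ℝ) : heisSmooth := c • X₁ + d • X₂
def linζ (b c d f : ℝ) : heisSmooth :=
  f • X₂ + d • X₃ + (c / 2) • (X₁ * X₁) + (b / 2) • (X₂ * X₂)

/-- The derivation of the algebra of smooth functions given by `𝒳`. -/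
def lieX (b c d f : ℝ) (F : heisSmooth) : heisSmooth :=
  linβ b * Dx F + linω c d * Dy F + linζ b c d f * Dz F

theorem ev_linβ (b : ℝ) (p : Heis) : ev p (linβ b) = b * p.2.1 := by simp [linβ]
theorem ev_linω (c d : ℝ) (p : Heis) : ev p (linω c d) = c * p.1 + d * p.2.1 := by simp [linω]
theorem ev_linζ (b c d f : ℝ) (p : Heis) :
    ev p (linζ b c d f) = f * p.2.1 + d * p.2.2 + c * p.1 ^ 2 / 2 + b * p.2.1 ^ 2 / 2 := by
  simp [linζ]; ring

theorem ev_lieX (b c d f : ℝ) (p : Heis) (F : heisSmooth) :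
    ev p (lieX b c d f F) = ev p (linβ b) * ev p (Dx F) + ev p (linω c d) * ev p (Dy F) +
      ev p (linζ b c d f) * ev p (Dz F) := by
  simp [lieX]

theorem pd_linβ (b : ℝ) (v : Heis) : pd v (linβ b) = algebraMap ℝ heisSmooth (b * v.2.1) := by
  simp [linβ, pd_X₂, Algebra.smul_def]
theorem pd_linω (c d : ℝ) (v : Heis) :
    pd v (linω c d) = algebraMap ℝ heisSmooth (c * v.1 + d * v.2.1) := by
  simp [linω, pd_X₁, pd_X₂, Algebra.smul_def]
theorem pd_linζ (b c d f : ℝ) (v : Heis) : pd v (linζ b c d f) =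
    algebraMap ℝ heisSmooth (f * v.2.1 + d * v.2.2) + (c * v.1) • X₁ + (b * v.2.1) • X₂ := by
  refine ext_ev fun p => ?_
  simp [linζ, pd_X₁, pd_X₂, pd_X₃]
  ring

theorem Dx_lieX (b c d f : ℝ) (F : heisSmooth) :
    Dx (lieX b c d f F) = lieX b c d f (Dx F) + c • Dy F + c • (X₁ * Dz F) := by
  refine ext_ev fun p => ?_
  simp [lieX, pd_linβ, pd_linω, pd_linζ, Dy_Dx, Dz_Dx]
  ring

theorem ev_Dz_eq_zero {c d : ℝ} {F : heisSmooth} {k : ℝ}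
    (h : ∀ p : Heis, c * p.1 + d * p.2.1 = 0 → ev p F = k) {p : Heis}
    (hp : c * p.1 + d * p.2.1 = 0) : ev p (Dz F) = 0 :=
  ev_pd_eq_zero_of_line (k := k) fun t => h _ (by simpa using hp)

theorem ev_Dy_eq {c d : ℝ} {F : heisSmooth} {k : ℝ}
    (h : ∀ p : Heis, c * p.1 + d * p.2.1 = 0 → ev p F = k) {p : Heis}
    (hp : c * p.1 + d * p.2.1 = 0) : c * ev p (Dy F) = d * ev p (Dx F) := by
  have := ev_pd_eq_zero_of_line (F := F) (p := p) (v := (-d, c, 0)) (k := k)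
    fun t => h _ (by simp; linear_combination hp)
  rw [ev_pd_eq] at this
  linear_combination this

/-- The components `φ, ψ, χ` of a map preserving the cometric `X² + Z² + 𝒳²` and the singular
surface, with `W` and `ζ'` the pullbacks of the last two components of `𝒳`. -/
structure IsCometricMap (b c d f : ℝ) (φ ψ χ W ζ' : heisSmooth) : Prop where
  W_eq : W = c • φ + d • ψ
  ζ'_eq : ζ' = f • ψ + d • χ + (c / 2) • (φ * φ) + (b / 2) • (ψ * ψ)
  ψψ : Dx ψ * Dx ψ + Dz ψ * Dz ψ + lieX b c d f ψ * lieX b c d f ψ = W * W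
  Wψ : Dx W * Dx ψ + Dz W * Dz ψ + lieX b c d f W * lieX b c d f ψ =
    W * ((c * b) • ψ + d • W)
  WW : Dx W * Dx W + Dz W * Dz W + lieX b c d f W * lieX b c d f W =
    algebraMap ℝ heisSmooth (c ^ 2) + ((c * b) • ψ + d • W) * ((c * b) • ψ + d • W)
  χψ : Dx χ * Dx ψ + Dz χ * Dz ψ + lieX b c d f χ * lieX b c d f ψ = W * ζ'
  χW : Dx χ * Dx W + Dz χ * Dz W + lieX b c d f χ * lieX b c d f W =
    ((c * b) • ψ + d • W) * ζ'
  χχ : Dx χ * Dx χ + Dz χ * Dz χ + lieX b c d f χ * lieX b c d f χ = 1 + ζ' * ζ'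
  ev_W : ∀ p : Heis, c * p.1 + d * p.2.1 = 0 → ev p W = 0

namespace IsCometricMap

variable {b c d f : ℝ} {φ ψ χ W ζ' : heisSmooth}

theorem ev_Dz_W (h : IsCometricMap b c d f φ ψ χ W ζ') {p : Heis}
    (hp : c * p.1 + d * p.2.1 = 0) : ev p (Dz W) = 0 :=
  ev_Dz_eq_zero h.ev_W hp

theorem ev_Dy_W (h : IsCometricMap b c d f φ ψ χ W ζ') {p : Heis}
    (hp : c * p.1 + d * p.2.1 = 0) : c * ev p (Dy W) = d * ev p (Dx W) :=
  ev_Dy_eq h.ev_W hp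

theorem ev_lieX_W (h : IsCometricMap b c d f φ ψ χ W ζ') {p : Heis}
    (hp : c * p.1 + d * p.2.1 = 0) : ev p (lieX b c d f W) = b * p.2.1 * ev p (Dx W) := by
  rw [ev_lieX, ev_linβ, ev_linω, hp, h.ev_Dz_W hp]; ring

theorem ev_Dx_Dz_ψ (h : IsCometricMap b c d f φ ψ χ W ζ') {p : Heis}
    (hp : c * p.1 + d * p.2.1 = 0) : ev p (Dx ψ) = 0 ∧ ev p (Dz ψ) = 0 := by
  have := congrArg (ev p) h.ψψ
  simp only [map_add, map_mul, h.ev_W p hp] at this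
  constructor <;> nlinarith [mul_self_nonneg (ev p (Dx ψ)), mul_self_nonneg (ev p (Dz ψ)),
    mul_self_nonneg (ev p (lieX b c d f ψ))]

theorem ev_lieX_ψ (h : IsCometricMap b c d f φ ψ χ W ζ') {p : Heis}
    (hp : c * p.1 + d * p.2.1 = 0) : ev p (lieX b c d f ψ) = 0 := by
  rw [ev_lieX, ev_linω, hp, (h.ev_Dx_Dz_ψ hp).1, (h.ev_Dx_Dz_ψ hp).2]; ring

theorem ev_lieX_χ {p : Heis}
    (hp : c * p.1 + d * p.2.1 = 0) : ev p (lieX b c d f χ) =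
      b * p.2.1 * ev p (Dx χ) + ev p (linζ b c d f) * ev p (Dz χ) := by
  rw [ev_lieX, ev_linω, ev_linβ, hp]; ring

theorem ev_second_ψ (h : IsCometricMap b c d f φ ψ χ W ζ') (hc : c ≠ 0) {p : Heis}
    (hp : c * p.1 + d * p.2.1 = 0) :
    ev p (Dx (Dz ψ)) = 0 ∧ ev p (Dz (Dz ψ)) = 0 ∧ ev p (Dy (Dz ψ)) = 0 ∧
      c * ev p (Dx (Dy ψ)) = d * ev p (Dx (Dx ψ)) := by
  have h1 := ev_Dz_eq_zero (fun p hp => (h.ev_Dx_Dz_ψ hp).1) hp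
  have h2 := ev_Dz_eq_zero (fun p hp => (h.ev_Dx_Dz_ψ hp).2) hp
  have h3 := ev_Dy_eq (fun p hp => (h.ev_Dx_Dz_ψ hp).1) hp
  have h4 := ev_Dy_eq (fun p hp => (h.ev_Dx_Dz_ψ hp).2) hp
  rw [Dz_Dx] at h1
  rw [Dy_Dx] at h3
  rw [h1, mul_zero] at h4
  exact ⟨h1, h2, (mul_eq_zero.1 h4).resolve_left hc, h3⟩

theorem ev_Dx_lieX_ψ (h : IsCometricMap b c d f φ ψ χ W ζ') (hc : c ≠ 0) {p : Heis}
    (hp : c * p.1 + d * p.2.1 = 0) :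
    ev p (Dx (lieX b c d f ψ)) = b * p.2.1 * ev p (Dx (Dx ψ)) + c * ev p (Dy ψ) := by
  have h2 := h.ev_second_ψ hc hp
  rw [Dx_lieX]
  simp only [map_add, map_smul, map_mul, ev_lieX, ev_linω, ev_linβ, hp, Dz_Dx, h2.1,
    (h.ev_Dx_Dz_ψ hp).2, smul_eq_mul]
  ring

/-- The first order jet relations along the singular surface. -/
theorem jet_one (h : IsCometricMap b c d f φ ψ χ W ζ') (hc : 0 < c) {p : Heis}
    (hp : c * p.1 + d * p.2.1 = 0) :
    ev p (Dx W) ^ 2 * (1 + (b * p.2.1) ^ 2) = c ^ 2 * (1 + (b * ev p ψ) ^ 2) ∧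
    ev p (Dy ψ) ^ 2 = 1 ∧ ev p (Dz χ) ^ 2 = 1 ∧
    ev p (Dx W) * ev p (linζ b c d f) * ev p (Dz χ) = c * ev p (Dy ψ) * ev p ζ' ∧
    (1 + (b * p.2.1) ^ 2) * ev p (Dx (Dx ψ)) =
      c * (b * ev p ψ - b * p.2.1 * ev p (Dy ψ)) := by
  have h1 : ev p (Dx W) ^ 2 * (1 + (b * p.2.1) ^ 2) = c ^ 2 * (1 + (b * ev p ψ) ^ 2) := by
    have := congrArg (ev p) h.WW
    simp only [map_add, map_mul, map_smul, h.ev_W p hp, h.ev_lieX_W hp, h.ev_Dz_W hp,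
      AlgHom.commutes, Algebra.algebraMap_self, RingHom.id_apply, smul_eq_mul] at this
    linear_combination this
  have hs : ev p (Dx W) ≠ 0 := by
    intro hs
    rw [hs] at h1
    have : 0 < c ^ 2 * (1 + (b * ev p ψ) ^ 2) := by positivity
    linarith
  have e1 := congrArg (ev p) (congrArg Dx (congrArg Dx h.ψψ))
  have e2 := congrArg (ev p) (congrArg Dx h.Wψ)
  have e4 := congrArg (ev p) (congrArg Dx h.χψ)
  have e5 := congrArg (ev p) h.χW
  have e6 := congrArg (ev p) h.χχ
  obtain ⟨ψx, ψz⟩ := h.ev_Dx_Dz_ψ hp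
  obtain ⟨ψxz, ψzz, ψyz, ψxy⟩ := h.ev_second_ψ hc.ne' hp
  have Lψ := h.ev_lieX_ψ hp
  have LW := h.ev_lieX_W hp
  have Lχ := ev_lieX_χ (b := b) (f := f) (χ := χ) hp
  have Wz := h.ev_Dz_W hp
  have W0 := h.ev_W p hp
  have xL := h.ev_Dx_lieX_ψ hc.ne' hp
  simp only [map_add, map_mul, map_smul, map_one, Derivation.leibniz, smul_eq_mul, Lψ, LW, Lχ, Wz,
    W0, xL, ψx, ψz, ψxz] at e1 e2 e4 e5 e6
  clear Lψ LW Lχ Wz W0 xL ψx ψz ψxz ψzz ψyz ψxy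
  generalize ev p (Dx W) = s at *
  generalize ev p (Dx (Dx ψ)) = a at *
  generalize ev p (Dy ψ) = e at *
  generalize ev p (Dx χ) = χx at *
  generalize ev p (Dz χ) = χz at *
  generalize ev p (linζ b c d f) = ζ at *
  generalize ev p ζ' = ζ₁ at *
  set β := b * p.2.1
  set β₁ := b * ev p ψ with hβ₁
  have e1' : a ^ 2 + (β * a + c * e) ^ 2 = s ^ 2 := by linear_combination e1 / 2
  have e2' : a + β * (β * a + c * e) = c * β₁ := by
    refine mul_left_cancel₀ hs ?_
    linear_combination e2
  have n1 : (1 + β ^ 2) ≠ 0 := by positivity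
  have ha : (1 + β ^ 2) * a = c * (β₁ - β * e) := by linear_combination e2'
  have hm : (1 + β ^ 2) * (β * a + c * e) = c * (β * β₁ + e) := by linear_combination β * ha
  have he : e ^ 2 = 1 := by
    have : c ^ 2 * (1 + β ^ 2) * e ^ 2 = c ^ 2 * (1 + β ^ 2) * 1 := by
      linear_combination (1 + β ^ 2) * h1 + (1 + β ^ 2) ^ 2 * e1' -
        ((1 + β ^ 2) * a + c * (β₁ - β * e)) * ha -
        ((1 + β ^ 2) * (β * a + c * e) + c * (β * β₁ + e)) * hm
    exact mul_left_cancel₀ (by positivity) this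
  have e4' : χx * a + (β * χx + ζ * χz) * (β * a + c * e) = s * ζ₁ := by linear_combination e4
  have e5' : s * (χx + β * (β * χx + ζ * χz)) = c * β₁ * ζ₁ := by linear_combination e5
  have e6' : χx ^ 2 + χz ^ 2 + (β * χx + ζ * χz) ^ 2 = 1 + ζ₁ ^ 2 := by linear_combination e6
  have k1 : s * ζ * χz = c * e * ζ₁ := by
    have : c * e * (s * ζ * χz) = c * e * (c * e * ζ₁) := by
      linear_combination (1 + β ^ 2) * s * e4' - s * χx * ha - s * (β * χx + ζ * χz) * hm +
        ζ₁ * h1 - c * β₁ * e5' - c ^ 2 * ζ₁ * he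
    have he0 : e ≠ 0 := by rintro rfl; norm_num at he
    exact mul_left_cancel₀ (mul_ne_zero hc.ne' he0) this
  have k2 : χz ^ 2 = 1 := by
    refine mul_left_cancel₀ (mul_ne_zero (pow_ne_zero 2 hs) n1) ?_
    linear_combination s ^ 2 * (1 + β ^ 2) * e6' -
      (s * (χx + β * (β * χx + ζ * χz)) + c * β₁ * ζ₁) * e5' -
      (s * ζ * χz + c * e * ζ₁) * k1 - c ^ 2 * ζ₁ ^ 2 * he + ζ₁ ^ 2 * h1
  exact ⟨h1, he, k2, k1, ha⟩

end IsCometricMap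
end heisSmooth

namespace heisSmooth
namespace IsCometricMap

variable {b c d f : ℝ} {φ ψ χ W ζ' : heisSmooth}

theorem ev_pd_W (h : IsCometricMap b c d f φ ψ χ W ζ') (p v : Heis) :
    ev p (pd v W) = c * ev p (pd v φ) + d * ev p (pd v ψ) := by
  simp [h.W_eq]

theorem ev_pd_ζ' (h : IsCometricMap b c d f φ ψ χ W ζ') (p v : Heis) :
    ev p (pd v ζ') = f * ev p (pd v ψ) + d * ev p (pd v χ) + c * ev p φ * ev p (pd v φ) +
      b * ev p ψ * ev p (pd v ψ) := by
  simp [h.ζ'_eq]; ring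

theorem ev_Dz_Dx_W (h : IsCometricMap b c d f φ ψ χ W ζ') (hc : 0 < c) {p : Heis}
    (hp : c * p.1 + d * p.2.1 = 0) : ev p (Dx (Dz W)) = 0 := by
  have := ev_Dz_eq_zero (F := Dx W * Dx W * (1 + linβ b * linβ b) - (c ^ 2 * b ^ 2) • (ψ * ψ))
    (k := c ^ 2) (fun p hp => by
      simp only [map_sub, map_add, map_mul, map_smul, map_one, smul_eq_mul, ev_linβ]
      linear_combination (h.jet_one hc hp).1) hp
  simp only [map_sub, map_add, map_mul, map_smul, Derivation.map_smul, map_one, smul_eq_mul, ev_linβ,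
    Derivation.leibniz, pd_linβ, mul_zero, map_zero, Derivation.map_one_eq_zero,
    (h.ev_Dx_Dz_ψ hp).2, Dz_Dx] at this
  have hs : ev p (Dx W) ≠ 0 := by
    intro hs
    have h1 := (h.jet_one hc hp).1
    rw [hs] at h1
    have : 0 < c ^ 2 * (1 + (b * ev p ψ) ^ 2) := by positivity
    linarith
  have n1 : 2 * (1 + (b * p.2.1) ^ 2) ≠ 0 := by positivity
  refine mul_left_cancel₀ (mul_ne_zero hs n1) ?_
  linear_combination this

theorem ev_second_χ (h : IsCometricMap b c d f φ ψ χ W ζ') (hc : 0 < c) {p : Heis}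
    (hp : c * p.1 + d * p.2.1 = 0) :
    ev p (Dz (Dz χ)) = 0 ∧ c * ev p (Dy (Dz χ)) = d * ev p (Dx (Dz χ)) := by
  have hz : ∀ p : Heis, c * p.1 + d * p.2.1 = 0 → ev p (Dz χ * Dz χ) = 1 := fun p hp => by
    rw [map_mul]; linear_combination (h.jet_one hc hp).2.2.1
  have h0 : ev p (Dz χ) ≠ 0 := by
    intro h0
    have := (h.jet_one hc hp).2.2.1
    rw [h0] at this
    norm_num at this
  have h1 := ev_Dz_eq_zero hz hp
  have h2 := ev_Dy_eq hz hp
  simp only [Derivation.leibniz, map_add, map_mul, smul_eq_mul] at h1 h2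
  constructor
  · exact mul_left_cancel₀ h0 (by linear_combination h1 / 2)
  · exact mul_left_cancel₀ h0 (by linear_combination h2 / 2)

theorem ev_Dy_Dy_ψ (h : IsCometricMap b c d f φ ψ χ W ζ') (hc : 0 < c) {p : Heis}
    (hp : c * p.1 + d * p.2.1 = 0) : c * ev p (Dy (Dy ψ)) = d * ev p (Dx (Dy ψ)) := by
  have hz : ∀ p : Heis, c * p.1 + d * p.2.1 = 0 → ev p (Dy ψ * Dy ψ) = 1 := fun p hp => by
    rw [map_mul]; linear_combination (h.jet_one hc hp).2.1
  have h0 : ev p (Dy ψ) ≠ 0 := by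
    intro h0
    have := (h.jet_one hc hp).2.1
    rw [h0] at this
    norm_num at this
  have h2 := ev_Dy_eq hz hp
  simp only [Derivation.leibniz, map_add, map_mul, smul_eq_mul] at h2
  exact mul_left_cancel₀ h0 (by linear_combination h2 / 2)

theorem ev_relation (h : IsCometricMap b c d f φ ψ χ W ζ') (hc : 0 < c) {p : Heis}
    (hp : c * p.1 + d * p.2.1 = 0) :
    ev p (Dx W * linζ b c d f * Dz χ - c • (Dy ψ * ζ')) = 0 := by
  simp only [map_sub, map_mul, map_smul, smul_eq_mul]
  linear_combination (h.jet_one hc hp).2.2.2.1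

theorem ev_Dx_W_eq (h : IsCometricMap b c d f φ ψ χ W ζ') (hc : 0 < c) (hd : d ≠ 0) {p : Heis}
    (hp : c * p.1 + d * p.2.1 = 0) : ev p (Dx W) = c * ev p (Dy ψ) := by
  have := ev_Dz_eq_zero (fun p hp => h.ev_relation hc hp) hp
  have hW := h.ev_pd_W p (0, 0, 1)
  rw [h.ev_Dz_W hp, (h.ev_Dx_Dz_ψ hp).2] at hW
  have hφz : ev p (Dz φ) = 0 := mul_left_cancel₀ hc.ne' (by linear_combination -hW)
  simp only [map_sub, map_mul, map_smul, Derivation.map_smul, smul_eq_mul, Derivation.leibniz, map_add, pd_linζ,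
    (h.ev_second_χ hc hp).1, Dz_Dx, Dz_Dy, h.ev_Dz_Dx_W hc hp, (h.ev_second_ψ hc.ne' hp).2.2.1,
    h.ev_pd_ζ', (h.ev_Dx_Dz_ψ hp).2, hφz, AlgHom.commutes, Algebra.algebraMap_self,
    RingHom.id_apply] at this
  have h0 : ev p (Dz χ) ≠ 0 := by
    intro h0
    have := (h.jet_one hc hp).2.2.1
    rw [h0] at this
    norm_num at this
  refine mul_left_cancel₀ (mul_ne_zero hd h0) ?_
  linear_combination this

/-- The image of the identity is a singularity of the linear vector field. -/
theorem base_point (h : IsCometricMap b c d f φ ψ χ W ζ') (hc : 0 < c) :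
    b * ev 0 ψ = 0 ∧ ev 0 ζ' = 0 := by
  have hp : c * (0 : Heis).1 + d * (0 : Heis).2.1 = 0 := by simp
  obtain ⟨j1, j2, j3, j4, -⟩ := h.jet_one hc hp
  have hζ : ev 0 (linζ b c d f) = 0 := by simp [ev_linζ]
  have he : ev 0 (Dy ψ) ≠ 0 := by
    intro h0
    rw [h0] at j2
    norm_num at j2
  have hζ' : ev 0 ζ' = 0 := by
    refine mul_left_cancel₀ (mul_ne_zero hc.ne' he) ?_
    rw [← j4, hζ]; ring
  refine ⟨?_, hζ'⟩
  simp only [Prod.snd_zero, Prod.fst_zero, mul_zero] at j1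
  by_cases hd : d = 0
  · subst hd
    have hφ : ev 0 φ = 0 := by
      have := h.ev_W 0 (by simp)
      rw [h.W_eq] at this
      simpa [hc.ne'] using this
    have := ev_Dy_eq (fun p hp => h.ev_relation hc hp) hp
    have e2 := h.ev_Dy_Dy_ψ hc hp
    have e3 : ev 0 (Dy (Dy ψ)) = 0 := mul_left_cancel₀ hc.ne' (by linear_combination e2)
    simp only [map_sub, map_mul, map_smul, Derivation.map_smul, smul_eq_mul, Derivation.leibniz, map_add, pd_linζ,
      h.ev_pd_ζ', AlgHom.commutes, Algebra.algebraMap_self, hζ, hζ', hφ, e3, ev_X₁, ev_X₂,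
      RingHom.id_apply, Prod.fst_zero, Prod.snd_zero] at this
    have hz := hζ'
    rw [h.ζ'_eq] at hz
    simp only [map_add, map_mul, map_smul, hφ, smul_eq_mul] at hz
    have k1 : ev 0 (Dx W) * ev 0 (Dz χ) * f = c * (f + b * ev 0 ψ) := by
      refine mul_left_cancel₀ hc.ne' ?_
      linear_combination this + c ^ 2 * (f + b * ev 0 ψ) * j2
    have k2 : b * ev 0 ψ * (2 * f + b * ev 0 ψ) = 0 := by linear_combination 2 * b * hz
    rcases mul_eq_zero.1 k2 with k | k
    · exact k
    have k3 : c ^ 2 * ((1 + (b * ev 0 ψ) ^ 2) * f ^ 2) = c ^ 2 * (f + b * ev 0 ψ) ^ 2 := by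
      linear_combination (ev 0 (Dx W) * ev 0 (Dz χ) * f + c * (f + b * ev 0 ψ)) * k1 - f ^ 2 * j1 -
        ev 0 (Dx W) ^ 2 * f ^ 2 * j3
    have k4 := mul_left_cancel₀ (pow_ne_zero 2 hc.ne') k3
    have k5 : b * ev 0 ψ = -2 * f := by linear_combination k
    rw [k5] at k4 ⊢
    have k6 : f ^ 4 = 0 := by linear_combination k4 / 4
    rw [pow_eq_zero_iff (by norm_num)] at k6
    simp [k6]
  · have hs := h.ev_Dx_W_eq hc hd hp
    have : c ^ 2 * (b * ev 0 ψ) ^ 2 = c ^ 2 * 0 := by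
      rw [hs] at j1
      linear_combination -j1 + c ^ 2 * j2
    have := mul_left_cancel₀ (pow_ne_zero 2 hc.ne') this
    exact pow_eq_zero_iff (by norm_num) |>.1 this

end IsCometricMap
end heisSmooth

namespace heisSmooth

theorem ev_axis_Dz_eq_zero {F : heisSmooth} {k : ℝ} (h : ∀ z : ℝ, ev (0, 0, z) F = k) (z : ℝ) :
    ev (0, 0, z) (Dz F) = 0 :=
  ev_pd_eq_zero_of_line (k := k) fun t => by simpa using h (z + t)

theorem ev_axis_eq_of_Dz {F : heisSmooth} (h : ∀ z : ℝ, ev (0, 0, z) (Dz F) = 0) (z : ℝ) :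
    ev (0, 0, z) F = ev 0 F := by
  have hd : ∀ z : ℝ, HasDerivAt (fun z : ℝ => F.1 (0, 0, z)) 0 z := by
    intro z
    have e1 : HasDerivAt (fun z : ℝ => ((0, 0, z) : Heis)) (0, 0, 1) z :=
      (hasDerivAt_const z 0).prodMk ((hasDerivAt_const z 0).prodMk (hasDerivAt_id z))
    exact ((heisSmooth.differentiable F (0, 0, z)).hasFDerivAt.comp_hasDerivAt z e1).congr_deriv
      (h z)
  exact is_const_of_deriv_eq_zero (fun z => (hd z).differentiableAt) (fun z => (hd z).deriv) z 0

namespace IsCometricMap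

variable {b c d f : ℝ} {φ ψ χ W ζ' : heisSmooth}

theorem ev_axis (h : IsCometricMap b c d f φ ψ χ W ζ') (hc : 0 < c) (hψ : ev 0 ψ = 0) (z : ℝ) :
    ev (0, 0, z) ψ = 0 ∧ ev (0, 0, z) (Dx W) ^ 2 = c ^ 2 ∧ ev (0, 0, z) (Dx (Dx ψ)) = 0 := by
  have hp : ∀ z : ℝ, c * ((0, 0, z) : Heis).1 + d * ((0, 0, z) : Heis).2.1 = 0 := by simp
  have hψz : ev (0, 0, z) ψ = 0 :=
    (ev_axis_eq_of_Dz (fun z => (h.ev_Dx_Dz_ψ (hp z)).2) z).trans hψ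
  obtain ⟨j1, -, -, -, j5⟩ := h.jet_one hc (hp z)
  rw [hψz] at j1 j5
  simp only [mul_zero] at j1 j5
  exact ⟨hψz, by linear_combination j1, by linear_combination j5⟩

theorem ev_axis_third_ψ (h : IsCometricMap b c d f φ ψ χ W ζ') (hc : 0 < c) (hψ : ev 0 ψ = 0)
    (z : ℝ) : ev (0, 0, z) (Dx (Dx (Dx ψ))) =
      2 * d * (ev (0, 0, z) (Dx W) - c * ev (0, 0, z) (Dy ψ)) := by
  have hp : c * ((0, 0, z) : Heis).1 + d * ((0, 0, z) : Heis).2.1 = 0 := by simp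
  obtain ⟨a1, a2, a3⟩ := h.ev_axis hc hψ z
  obtain ⟨ψx, ψz⟩ := h.ev_Dx_Dz_ψ hp
  obtain ⟨ψxz, -, -, -⟩ := h.ev_second_ψ hc.ne' hp
  have xL := h.ev_Dx_lieX_ψ hc.ne' hp
  have Wxz := h.ev_Dz_Dx_W hc hp
  have hs : ev (0, 0, z) (Dx W) ≠ 0 := by
    intro hs
    rw [hs] at a2
    have : 0 < c ^ 2 := by positivity
    linarith
  have e := congrArg (ev (0, 0, z)) (congrArg Dx (congrArg Dx h.Wψ))
  have xLW : ev (0, 0, z) (Dx (lieX b c d f W)) = d * ev (0, 0, z) (Dx W) := by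
    rw [Dx_lieX]
    simp only [map_add, map_mul, map_smul, ev_lieX, ev_linβ, ev_linω, smul_eq_mul, ev_X₁, Dz_Dx,
      Wxz]
    linear_combination h.ev_Dy_W hp
  simp only [map_add, map_mul, map_smul, Derivation.map_smul, Derivation.leibniz, smul_eq_mul,
    h.ev_W _ hp, h.ev_Dz_W hp, h.ev_lieX_W hp, h.ev_lieX_ψ hp, a1, a3, ψx, ψz, ψxz, xL, Wxz,
    xLW] at e
  refine mul_left_cancel₀ hs ?_
  linear_combination e

end IsCometricMap
end heisSmooth

namespace heisSmooth
namespace IsCometricMap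

variable {b c d f : ℝ} {φ ψ χ W ζ' : heisSmooth}

theorem second_W (h : IsCometricMap b c d f φ ψ χ W ζ') (hc : 0 < c) (hψ : ev 0 ψ = 0) :
    ev 0 (Dx (Dx W)) = 0 ∧ ev 0 (Dx (Dy W)) = 0 ∧ ev 0 (Dy (Dy W)) = 0 ∧
      ev 0 (Dx (Dz W)) = 0 ∧ ev 0 (Dy (Dz W)) = 0 ∧ ev 0 (Dz (Dz W)) = 0 := by
  have hp : c * (0 : Heis).1 + d * (0 : Heis).2.1 = 0 := by simp
  have a2 : ev 0 (Dx W) ^ 2 = c ^ 2 := (h.ev_axis hc hψ 0).2.1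
  have hs : ev 0 (Dx W) ≠ 0 := by
    intro hs
    rw [hs] at a2
    have : 0 < c ^ 2 := by positivity
    linarith
  have Wxz := h.ev_Dz_Dx_W hc hp
  have Wzz := ev_Dz_eq_zero (fun p hp => h.ev_Dz_W hp) hp
  have Wyz := ev_Dy_eq (fun p hp => h.ev_Dz_W hp) hp
  have Wyy := ev_Dy_eq (F := c • Dy W - d • Dx W) (k := 0)
    (fun p hp => by simp only [map_sub, map_smul, smul_eq_mul]; linear_combination h.ev_Dy_W hp) hp
  have e := congrArg (ev 0) (congrArg Dx h.WW)
  have T := ev_Dy_eq (F := Dx W * Dx W * (1 + linβ b * linβ b) - (c ^ 2 * b ^ 2) • (ψ * ψ))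
    (k := c ^ 2) (fun p hp => by
      simp only [map_sub, map_add, map_mul, map_smul, map_one, smul_eq_mul, ev_linβ]
      linear_combination (h.jet_one hc hp).1) hp
  have L0 : ev 0 (lieX b c d f W) = 0 := by rw [h.ev_lieX_W hp]; simp
  simp only [map_sub, map_add, map_mul, map_smul, Derivation.map_smul, map_one, smul_eq_mul, ev_linβ,
    Derivation.leibniz, pd_linβ, map_zero, Derivation.map_one_eq_zero, Dy_Dx, Prod.fst_zero,
    Prod.snd_zero, hψ, L0, h.ev_W 0 hp, h.ev_Dz_W hp, Derivation.map_algebraMap] at e T Wyy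
  have Wxx : ev 0 (Dx (Dx W)) = 0 := mul_left_cancel₀ hs (by linear_combination e / 2)
  rw [Wxx] at T Wyy
  have Wxy : ev 0 (Dx (Dy W)) = 0 :=
    mul_left_cancel₀ (mul_ne_zero hc.ne' hs) (by linear_combination T / 2)
  rw [Wxz] at Wyz
  rw [Wxy] at Wyy
  refine ⟨Wxx, Wxy, ?_, Wxz, ?_, Wzz⟩
  · exact mul_left_cancel₀ (mul_ne_zero hc.ne' hc.ne') (by linear_combination Wyy)
  · exact mul_left_cancel₀ hc.ne' (by linear_combination Wyz)

theorem second_ψ (h : IsCometricMap b c d f φ ψ χ W ζ') (hc : 0 < c) (hψ : ev 0 ψ = 0) :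
    ev 0 (Dx (Dx ψ)) = 0 ∧ ev 0 (Dx (Dy ψ)) = 0 ∧ ev 0 (Dy (Dy ψ)) = 0 ∧
      ev 0 (Dx (Dz ψ)) = 0 ∧ ev 0 (Dy (Dz ψ)) = 0 ∧ ev 0 (Dz (Dz ψ)) = 0 := by
  have hp : c * (0 : Heis).1 + d * (0 : Heis).2.1 = 0 := by simp
  have a3 : ev 0 (Dx (Dx ψ)) = 0 := (h.ev_axis hc hψ 0).2.2
  obtain ⟨xz, zz, yz, xy⟩ := h.ev_second_ψ hc.ne' hp
  have yy := h.ev_Dy_Dy_ψ hc hp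
  have xy0 : ev 0 (Dx (Dy ψ)) = 0 := mul_left_cancel₀ hc.ne' (by rw [xy, a3]; ring)
  exact ⟨a3, xy0, mul_left_cancel₀ hc.ne' (by rw [yy, xy0]; ring), xz, yz, zz⟩

theorem ev_pd_φ (h : IsCometricMap b c d f φ ψ χ W ζ') (hc : c ≠ 0) {p u v : Heis}
    (hW : ev p (pd u (pd v W)) = 0) (hψ : ev p (pd u (pd v ψ)) = 0) :
    ev p (pd u (pd v φ)) = 0 := by
  have : ev p (pd u (pd v W)) = c * ev p (pd u (pd v φ)) + d * ev p (pd u (pd v ψ)) := by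
    rw [h.W_eq]; simp
  rw [hW, hψ] at this
  exact mul_left_cancel₀ hc (by linear_combination -this)

/-- The second derivative of the first component vanishes at a fixed point. -/
theorem second_φ (h : IsCometricMap b c d f φ ψ χ W ζ') (hc : 0 < c) (hψ : ev 0 ψ = 0)
    (u v : Heis) : ev 0 (pd u (pd v φ)) = 0 := by
  obtain ⟨w1, w2, w3, w4, w5, w6⟩ := h.second_W hc hψ
  obtain ⟨p1, p2, p3, p4, p5, p6⟩ := h.second_ψ hc hψ
  rw [ev_pd_eq, pd_comm _ v, pd_comm _ v, pd_comm _ v, ev_pd_eq, ev_pd_eq 0 v, ev_pd_eq 0 v, Dy_Dx,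
    Dz_Dx, Dz_Dy, h.ev_pd_φ hc.ne' w1 p1, h.ev_pd_φ hc.ne' w2 p2, h.ev_pd_φ hc.ne' w3 p3,
    h.ev_pd_φ hc.ne' w4 p4, h.ev_pd_φ hc.ne' w5 p5, h.ev_pd_φ hc.ne' w6 p6]
  ring

end IsCometricMap
end heisSmooth

namespace heisSmooth
namespace IsCometricMap

variable {b c d f : ℝ} {φ ψ χ W ζ' : heisSmooth}

theorem ev_Dx_W_sq (h : IsCometricMap b c d f φ ψ χ W ζ') (hc : 0 < c) (hψ : ev 0 ψ = 0) :
    ev 0 (Dx W) ^ 2 = c ^ 2 ∧ ev 0 (Dx W) ≠ 0 := by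
  have a2 : ev 0 (Dx W) ^ 2 = c ^ 2 := (h.ev_axis hc hψ 0).2.1
  refine ⟨a2, fun hs => ?_⟩
  rw [hs] at a2
  have : 0 < c ^ 2 := by positivity
  linarith

theorem ev_Dx_Dy_χ (h : IsCometricMap b c d f φ ψ χ W ζ') (hc : 0 < c) (hψ : ev 0 ψ = 0)
    (hζ' : ev 0 ζ' = 0) :
    ev 0 (Dx χ) = 0 ∧ ev 0 (Dy χ) = 0 ∧ ev 0 (Dx (Dx χ)) = 0 ∧ ev 0 (Dx (Dy χ)) = 0 := by
  have hp : c * (0 : Heis).1 + d * (0 : Heis).2.1 = 0 := by simp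
  have hs := (h.ev_Dx_W_sq hc hψ).2
  obtain ⟨j1, j2, j3, j4, -⟩ := h.jet_one hc hp
  have he : ev 0 (Dy ψ) ≠ 0 := by
    intro h0
    rw [h0] at j2
    norm_num at j2
  obtain ⟨w1, w2, w3, w4, w5, w6⟩ := h.second_W hc hψ
  obtain ⟨p1, p2, p3, p4, p5, p6⟩ := h.second_ψ hc hψ
  obtain ⟨ψx, ψz⟩ := h.ev_Dx_Dz_ψ hp
  have LW : ev 0 (lieX b c d f W) = 0 := by rw [h.ev_lieX_W hp]; simp
  have Lψ := h.ev_lieX_ψ hp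
  have Lχ : ev 0 (lieX b c d f χ) = 0 := by rw [ev_lieX_χ hp, ev_linζ]; simp
  have χx : ev 0 (Dx χ) = 0 := by
    have := congrArg (ev 0) h.χW
    simp only [map_add, map_mul, map_smul, smul_eq_mul, LW, hζ', h.ev_Dz_W hp] at this
    exact mul_left_cancel₀ hs (by linear_combination this)
  have T := ev_Dy_eq (F := Dx W * (Dx χ + linβ b * lieX b c d f χ) - (c * b) • (ψ * ζ')) (k := 0)
    (fun p hp => by
      have := congrArg (ev p) h.χW
      simp only [map_add, map_mul, map_smul, smul_eq_mul, h.ev_lieX_W hp, h.ev_Dz_W hp,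
        h.ev_W p hp] at this
      simp only [map_sub, map_add, map_mul, map_smul, smul_eq_mul, ev_linβ]
      linear_combination this) hp
  have xLψ := h.ev_Dx_lieX_ψ hc.ne' hp
  have xLχ : ev 0 (Dx (lieX b c d f χ)) = c * ev 0 (Dy χ) := by
    rw [Dx_lieX]
    simp [ev_lieX, ev_linβ, ev_linω, ev_linζ]
  have ψxxz : ev 0 (Dx (Dx (Dz ψ))) = 0 := by
    rw [← Dz_Dx, ← Dz_Dx]
    exact ev_axis_Dz_eq_zero (fun z => (h.ev_axis hc hψ z).2.2) 0
  have e1 := congrArg (ev 0) (congrArg Dx (congrArg Dx h.χψ))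
  have e2 := congrArg (ev 0) (congrArg Dx h.χW)
  simp only [map_sub, map_add, map_mul, map_smul, Derivation.map_smul, smul_eq_mul, ev_linβ,
    Derivation.leibniz, pd_linβ, map_zero, Dy_Dx, Prod.fst_zero, Prod.snd_zero, hψ, hζ', ψx, ψz,
    χx, p1, p4, w1, w4, Lχ, Lψ, LW, xLψ, xLχ, ψxxz, h.ev_W 0 hp, h.ev_Dz_W hp, h.ev_pd_ζ'] at e1 e2 T
  have hφ : ev 0 φ = 0 := by
    have := h.ev_W 0 hp
    rw [h.W_eq] at this
    simp only [map_add, map_smul, smul_eq_mul, hψ] at this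
    exact mul_left_cancel₀ hc.ne' (by linear_combination this)
  rw [hφ] at e1
  have χy : ev 0 (Dy χ) = 0 := by
    refine mul_left_cancel₀ (mul_ne_zero (mul_ne_zero hc.ne' hc.ne') he) ?_
    linear_combination e1 / 2
  have χxx : ev 0 (Dx (Dx χ)) = 0 := mul_left_cancel₀ hs (by linear_combination e2)
  rw [χxx] at T
  exact ⟨χx, χy, χxx, mul_left_cancel₀ (mul_ne_zero hc.ne' hs) (by linear_combination T)⟩

theorem ev_Dz_χ (h : IsCometricMap b c d f φ ψ χ W ζ') (hc : 0 < c) (hψ : ev 0 ψ = 0)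
    (hζ' : ev 0 ζ' = 0) : c * ev 0 (Dz χ) * ev 0 (Dy ψ) = ev 0 (Dx W) := by
  have hp : c * (0 : Heis).1 + d * (0 : Heis).2.1 = 0 := by simp
  obtain ⟨s2, hs⟩ := h.ev_Dx_W_sq hc hψ
  obtain ⟨χx, χy, χxx, χxy⟩ := h.ev_Dx_Dy_χ hc hψ hζ'
  obtain ⟨w1, w2, w3, w4, w5, w6⟩ := h.second_W hc hψ
  obtain ⟨p1, p2, p3, p4, p5, p6⟩ := h.second_ψ hc hψ
  obtain ⟨ψx, ψz⟩ := h.ev_Dx_Dz_ψ hp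
  have Lψ := h.ev_lieX_ψ hp
  have Lχ : ev 0 (lieX b c d f χ) = 0 := by rw [ev_lieX_χ hp, ev_linζ]; simp
  have xLψ := h.ev_Dx_lieX_ψ hc.ne' hp
  have xLχ : ev 0 (Dx (lieX b c d f χ)) = 0 := by
    rw [Dx_lieX]
    simp [ev_lieX, ev_linβ, ev_linω, ev_linζ, χy]
  have xxLχ : ev 0 (Dx (Dx (lieX b c d f χ))) = c * ev 0 (Dz χ) := by
    rw [Dx_lieX, map_add, map_add, map_add, map_add, Dx_lieX]
    simp [ev_lieX, ev_linβ, ev_linω, ev_linζ, χxy, pd_X₁, Dy_Dx]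
  have ψxxz : ev 0 (Dx (Dx (Dz ψ))) = 0 := by
    rw [← Dz_Dx, ← Dz_Dx]
    exact ev_axis_Dz_eq_zero (fun z => (h.ev_axis hc hψ z).2.2) 0
  have ψxxxz : ev 0 (Dx (Dx (Dx (Dz ψ)))) = 0 := by
    rw [← Dz_Dx, ← Dz_Dx, ← Dz_Dx]
    have := ev_axis_Dz_eq_zero (k := 0)
      (F := Dx (Dx (Dx ψ)) - (2 * d) • (Dx W - c • Dy ψ)) (fun z => by
        simp only [map_sub, map_smul, smul_eq_mul]
        linear_combination h.ev_axis_third_ψ hc hψ z) 0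
    change ev 0 _ = 0 at this
    simp only [map_sub, map_smul, Derivation.map_smul, smul_eq_mul, Dz_Dx, Dz_Dy, w4, p5] at this
    simp only [Dz_Dx]
    linear_combination this
  have xζ' : ev 0 (Dx ζ') = 0 := by
    have hφ : ev 0 φ = 0 := by
      have := h.ev_W 0 hp
      rw [h.W_eq] at this
      simp only [map_add, map_smul, smul_eq_mul, hψ] at this
      exact mul_left_cancel₀ hc.ne' (by linear_combination this)
    rw [h.ev_pd_ζ', ψx, χx, hφ, hψ]; ring
  have hφx : c * ev 0 (Dx φ) = ev 0 (Dx W) := by rw [h.ev_pd_W, ψx]; ring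
  have xxζ' : ev 0 (Dx (Dx ζ')) = c * ev 0 (Dx φ) ^ 2 := by
    rw [h.ζ'_eq]
    simp only [map_add, map_mul, map_smul, Derivation.map_smul, smul_eq_mul, Derivation.leibniz,
      p1, χxx, ψx, h.second_φ hc hψ]
    ring
  have e1 := congrArg (ev 0) (congrArg Dx (congrArg Dx (congrArg Dx h.χψ)))
  simp only [map_add, map_mul, smul_eq_mul, 
    Derivation.leibniz, hζ', ψx, ψz,
    χx, χxx, p1, p4, w1, Lχ, Lψ, xLψ, xLχ, xxLχ, ψxxz, ψxxxz, h.ev_W 0 hp, xζ', xxζ'] at e1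
  refine mul_left_cancel₀ (mul_ne_zero hc.ne' hc.ne') ?_
  simp only [Prod.fst_zero, Prod.snd_zero] at e1
  linear_combination c * e1 / 3 + ev 0 (Dx W) * (c * ev 0 (Dx φ) + ev 0 (Dx W)) * hφx +
    ev 0 (Dx W) * s2

/-- The first order jet of a cometric map at a fixed point. -/
theorem jet_fixed (h : IsCometricMap b c d f φ ψ χ W ζ') (hc : 0 < c) (hψ : ev 0 ψ = 0)
    (hζ' : ev 0 ζ' = 0) : ∃ u ε : ℝ, u ^ 2 = 1 ∧ ε ^ 2 = 1 ∧ (d ≠ 0 → ε = 1) ∧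
      (f ≠ 0 → ε = u) ∧ (∀ v : Heis, ev 0 (pd v φ) = u * v.1) ∧
      (∀ v : Heis, ev 0 (pd v ψ) = u * ε * v.2.1) ∧ ∀ v : Heis, ev 0 (pd v χ) = ε * v.2.2 := by
  have hp : c * (0 : Heis).1 + d * (0 : Heis).2.1 = 0 := by simp
  obtain ⟨s2, hs⟩ := h.ev_Dx_W_sq hc hψ
  obtain ⟨j1, j2, j3, j4, -⟩ := h.jet_one hc hp
  have key := h.ev_Dz_χ hc hψ hζ'
  obtain ⟨χx, χy, χxx, χxy⟩ := h.ev_Dx_Dy_χ hc hψ hζ'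
  obtain ⟨ψx, ψz⟩ := h.ev_Dx_Dz_ψ hp
  have hφx : c * ev 0 (Dx φ) = ev 0 (Dx W) := by rw [h.ev_pd_W, ψx]; ring
  have hφz : ev 0 (Dz φ) = 0 := by
    have := h.ev_pd_W 0 (0, 0, 1)
    rw [h.ev_Dz_W hp, ψz] at this
    exact mul_left_cancel₀ hc.ne' (by linear_combination -this)
  have he : ev 0 (Dy ψ) = ev 0 (Dx φ) * ev 0 (Dz χ) := by
    refine mul_left_cancel₀ hc.ne' ?_
    linear_combination -ev 0 (Dz χ) * hφx + ev 0 (Dz χ) * key - c * ev 0 (Dy ψ) * j3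
  have hu : ev 0 (Dx φ) ^ 2 = 1 := by
    refine mul_left_cancel₀ (pow_ne_zero 2 hc.ne') ?_
    linear_combination (c * ev 0 (Dx φ) + ev 0 (Dx W)) * hφx + s2
  have hu0 : ev 0 (Dx φ) ≠ 0 := by
    intro h0
    rw [h0] at hu
    norm_num at hu
  have hd1 : d ≠ 0 → ev 0 (Dz χ) = 1 := fun hd => by
    have := h.ev_Dx_W_eq hc hd hp
    rw [he, ← hφx] at this
    exact mul_left_cancel₀ (mul_ne_zero hc.ne' hu0) (by linear_combination -this)
  have hφy : ev 0 (Dy φ) = 0 := by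
    have := h.ev_Dy_W hp
    rw [h.ev_pd_W] at this
    refine mul_left_cancel₀ (mul_ne_zero hc.ne' hc.ne') ?_
    by_cases hd : d = 0
    · subst hd
      linear_combination this
    · rw [he, hd1 hd, ← hφx] at this
      linear_combination this
  refine ⟨ev 0 (Dx φ), ev 0 (Dz χ), hu, j3, hd1, fun hf => ?_, fun v => ?_, fun v => ?_, fun v => ?_⟩
  · have := ev_Dy_eq (fun p hp => h.ev_relation hc hp) hp
    simp only [map_sub, map_mul, map_smul, Derivation.map_smul, smul_eq_mul, Derivation.leibniz,
      map_add, pd_linζ, h.ev_pd_ζ', AlgHom.commutes, Algebra.algebraMap_self, hζ', hψ, χx, χy, ψx,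
      ev_linζ, hφy, ev_X₁, ev_X₂, RingHom.id_apply, Prod.fst_zero, Prod.snd_zero, he, ← hφx] at this
    have hφ : ev 0 φ = 0 := by
      have := h.ev_W 0 hp
      rw [h.W_eq] at this
      simp only [map_add, map_smul, smul_eq_mul, hψ] at this
      exact mul_left_cancel₀ hc.ne' (by linear_combination this)
    rw [hφ] at this
    refine mul_left_cancel₀ (mul_ne_zero (mul_ne_zero (mul_ne_zero hc.ne' hc.ne') hf) hu0) ?_
    linear_combination this - c ^ 2 * f * hu + c ^ 2 * f * ev 0 (Dx φ) ^ 2 * j3 + c ^ 2 * f * hu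
  · rw [ev_pd_eq, hφy, hφz]; ring
  · rw [ev_pd_eq, ψx, ψz, he]; ring
  · rw [ev_pd_eq, χx, χy]; ring

end IsCometricMap
end heisSmooth

namespace heisSmooth

/-- The composition of a smooth self-map of the group with a linear form. -/
def pull {Φ : Heis → Heis} (hΦ : ContDiff ℝ (⊤ : ℕ∞) Φ) (P : Heis →L[ℝ] ℝ) : heisSmooth :=
  ⟨fun p => P (Φ p), mem_iff.2 (P.contDiff.comp hΦ)⟩

variable {b c d f : ℝ} {Φ : Heis → Heis}

theorem ev_pull (hΦ : ContDiff ℝ (⊤ : ℕ∞) Φ) (P : Heis →L[ℝ] ℝ) (p : Heis) :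
    ev p (pull hΦ P) = P (Φ p) := rfl

theorem ev_pd_pull (hΦ : ContDiff ℝ (⊤ : ℕ∞) Φ) (P : Heis →L[ℝ] ℝ) (p v : Heis) :
    ev p (pd v (pull hΦ P)) = P (fderiv ℝ Φ p v) :=
  DFunLike.congr_fun
    (P.hasFDerivAt.comp p (hΦ.differentiable (by simp) p).hasFDerivAt).fderiv v

theorem ev_lieX_eq_fderiv (F : heisSmooth) (p : Heis) :
    ev p (lieX b c d f F) = fderiv ℝ F.1 p (subalgLin b c d f p) := by
  rw [← ev_pd, ev_pd_eq, ev_lieX, ev_linβ, ev_linω, ev_linζ]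
  rfl

theorem ev_lieX_pull (hΦ : ContDiff ℝ (⊤ : ℕ∞) Φ) (P : Heis →L[ℝ] ℝ) (p : Heis) :
    ev p (lieX b c d f (pull hΦ P)) = P (fderiv ℝ Φ p (subalgLin b c d f p)) := by
  rw [ev_lieX_eq_fderiv, ← ev_pd, ev_pd_pull]

theorem ev_cometric_pull (hc : 0 < c)
    (hΦ : IsHeisIsometry (subalgNormal b c d f) (subalgNormal b c d f) Φ) (P Q : Heis →L[ℝ] ℝ)
    (p : Heis) :
    ev p (Dx (pull hΦ.1.smooth P) * Dx (pull hΦ.1.smooth Q) +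
        Dz (pull hΦ.1.smooth P) * Dz (pull hΦ.1.smooth Q) +
        lieX b c d f (pull hΦ.1.smooth P) * lieX b c d f (pull hΦ.1.smooth Q)) =
      P (1, 0, 0) * Q (1, 0, 0) + P (0, 0, 1) * Q (0, 0, 1) +
        P (subalgLin b c d f (Φ p)) * Q (subalgLin b c d f (Φ p)) := by
  have := congrArg Q (hΦ.cometric hc p P)
  simpa only [map_add, map_mul, map_smul, ev_pd_pull, ev_lieX_pull, smul_eq_mul] using this

/-- The coordinate forms, as continuous linear forms. -/
def formX : Heis →L[ℝ] ℝ := ContinuousLinearMap.fst ℝ ℝ (ℝ × ℝ)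
def formY : Heis →L[ℝ] ℝ :=
  (ContinuousLinearMap.fst ℝ ℝ ℝ).comp (ContinuousLinearMap.snd ℝ ℝ (ℝ × ℝ))
def formZ : Heis →L[ℝ] ℝ :=
  (ContinuousLinearMap.snd ℝ ℝ ℝ).comp (ContinuousLinearMap.snd ℝ ℝ (ℝ × ℝ))

theorem formX_apply (v : Heis) : formX v = v.1 := rfl
theorem formY_apply (v : Heis) : formY v = v.2.1 := rfl
theorem formZ_apply (v : Heis) : formZ v = v.2.2 := rfl

theorem isCometricMap_pull (hc : 0 < c)
    (hΦ : IsHeisIsometry (subalgNormal b c d f) (subalgNormal b c d f) Φ) :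
    IsCometricMap b c d f (pull hΦ.1.smooth formX) (pull hΦ.1.smooth formY)
      (pull hΦ.1.smooth formZ) (pull hΦ.1.smooth (c • formX + d • formY))
      (f • pull hΦ.1.smooth formY + d • pull hΦ.1.smooth formZ +
        (c / 2) • (pull hΦ.1.smooth formX * pull hΦ.1.smooth formX) +
        (b / 2) • (pull hΦ.1.smooth formY * pull hΦ.1.smooth formY)) where
  W_eq := rfl
  ζ'_eq := rfl
  ψψ := by
    refine ext_ev fun p => ?_
    rw [ev_cometric_pull hc hΦ]
    simp [formX_apply, formY_apply, ev_pull, subalgLin]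
  Wψ := by
    refine ext_ev fun p => ?_
    rw [ev_cometric_pull hc hΦ]
    simp [formX_apply, formY_apply, ev_pull, subalgLin]
    ring
  WW := by
    refine ext_ev fun p => ?_
    rw [ev_cometric_pull hc hΦ]
    simp [formX_apply, formY_apply, ev_pull, subalgLin]
    ring
  χψ := by
    refine ext_ev fun p => ?_
    rw [ev_cometric_pull hc hΦ]
    simp [formX_apply, formY_apply, formZ_apply, ev_pull, subalgLin]
    ring
  χW := by
    refine ext_ev fun p => ?_
    rw [ev_cometric_pull hc hΦ]
    simp [formX_apply, formY_apply, formZ_apply, ev_pull, subalgLin]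
    ring
  χχ := by
    refine ext_ev fun p => ?_
    rw [ev_cometric_pull hc hΦ]
    simp [formX_apply, formY_apply, formZ_apply, ev_pull, subalgLin]
    ring
  ev_W := fun p hp => (hΦ.regular_iff p).2 hp

end heisSmooth

section FirstJets

open heisSmooth

variable {b c d f : ℝ} {Φ : Heis → Heis}

theorem IsHeisIsometry.map_one_mem (hc : 0 < c)
    (hΦ : IsHeisIsometry (subalgNormal b c d f) (subalgNormal b c d f) Φ) :
    Φ 0 ∈ (subalgNormal b c d f).linSingularities := by
  have h := isCometricMap_pull hc hΦ
  obtain ⟨h1, h2⟩ := h.base_point hc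
  have h3 := (hΦ.regular_iff 0).2 (by simp)
  rw [mem_linSingularities]
  rw [ev_pull, formY_apply] at h1
  simp only [map_add, map_mul, map_smul, smul_eq_mul, ev_pull, formX_apply, formY_apply,
    formZ_apply] at h2
  exact ⟨h1, h3, by linear_combination h2 - (Φ 0).2.1 * h1 / 2⟩

/-- The differential at the identity of an isometry fixing the identity. -/
theorem IsHeisIsometry.jet_of_map_one (hc : 0 < c)
    (hΦ : IsHeisIsometry (subalgNormal b c d f) (subalgNormal b c d f) Φ) (h0 : Φ 0 = 0) :
    ∃ u ε : ℝ, u ^ 2 = 1 ∧ ε ^ 2 = 1 ∧ (d ≠ 0 → ε = 1) ∧ (f ≠ 0 → ε = u) ∧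
      ∀ v : Heis, fderiv ℝ Φ 0 v = (u * v.1, u * ε * v.2.1, ε * v.2.2) := by
  have h := isCometricMap_pull hc hΦ
  obtain ⟨u, ε, hu, hε, hd, hf, h1, h2, h3⟩ := h.jet_fixed hc
    (by rw [ev_pull, h0, map_zero]) (by simp [ev_pull, h0])
  refine ⟨u, ε, hu, hε, hd, hf, fun v => ?_⟩
  have e1 := h1 v
  have e2 := h2 v
  have e3 := h3 v
  rw [ev_pd_pull] at e1 e2 e3
  exact Prod.ext e1 (Prod.ext e2 e3)

theorem IsHeisIsometry.fst_second_fderiv_eq_zero (hc : 0 < c)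
    (hΦ : IsHeisIsometry (subalgNormal b c d f) (subalgNormal b c d f) Φ) (h0 : Φ 0 = 0)
    (u v : Heis) : (fderiv ℝ (fderiv ℝ Φ) 0 u v).1 = 0 := by
  have h := isCometricMap_pull hc hΦ
  have := h.second_φ hc (by rw [ev_pull, h0, map_zero]) u v
  have e : (pd v (pull hΦ.1.smooth formX)).1 = fun p => formX (fderiv ℝ Φ p v) :=
    funext fun p => ev_pd_pull hΦ.1.smooth formX p v
  rw [ev_pd, e] at this
  have hd : DifferentiableAt ℝ (fderiv ℝ Φ) 0 :=
    (hΦ.1.smooth.fderiv_right (m := (⊤ : ℕ∞)) (by simp)).differentiable (by simp) 0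
  have e2 : fderiv ℝ (fun p => formX (fderiv ℝ Φ p v)) 0 = _ :=
    (formX.hasFDerivAt.comp 0 (hd.hasFDerivAt.clm_apply (hasFDerivAt_const v 0))).fderiv
  rw [e2] at this
  simpa [formX_apply] using this

end FirstJets

section LeviCivita

set_option maxSynthPendingDepth 3

variable {E : Type*} [NormedAddCommGroup E] [NormedSpace ℝ E]

/-- The Christoffel symbols of the first kind of a field of bilinear forms. -/
def christoffelForm (G : E → E →L[ℝ] E →L[ℝ] ℝ) (q : E) : E →L[ℝ] E →L[ℝ] E →L[ℝ] ℝ :=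
  (1 / 2 : ℝ) • (fderiv ℝ G q + (fderiv ℝ G q).flip -
    ((ContinuousLinearMap.flipₗᵢ ℝ E E ℝ).toContinuousLinearEquiv :
      (E →L[ℝ] E →L[ℝ] ℝ) →L[ℝ] E →L[ℝ] E →L[ℝ] ℝ).comp (fderiv ℝ G q).flip)

theorem christoffelForm_apply (G : E → E →L[ℝ] E →L[ℝ] ℝ) (q u v t : E) :
    christoffelForm G q u v t =
      (fderiv ℝ G q u v t + fderiv ℝ G q v u t - fderiv ℝ G q t u v) / 2 := by
  simp [christoffelForm]
  ring

theorem contDiffAt_christoffelForm {G : E → E →L[ℝ] E →L[ℝ] ℝ} {q : E} (hG : ContDiffAt ℝ 2 G q) :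
    ContDiffAt ℝ 1 (christoffelForm G) q := by
  have h1 : ContDiffAt ℝ 1 (fderiv ℝ G) q := hG.fderiv_right (by norm_num)
  have h2 : ContDiffAt ℝ 1 (fun q => (fderiv ℝ G q).flip) q :=
    (ContinuousLinearMap.flipₗᵢ ℝ E E (E →L[ℝ] ℝ)).toContinuousLinearEquiv.contDiff.contDiffAt.comp
      q h1
  exact ((h1.add h2).sub (contDiffAt_const.clm_comp h2)).const_smul (1 / 2 : ℝ)

/-- The Christoffel symbols obtained by raising an index with `S`. -/
def christoffel (G : E → E →L[ℝ] E →L[ℝ] ℝ) (S : E → (E →L[ℝ] ℝ) →L[ℝ] E) (q : E) :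
    E →L[ℝ] E →L[ℝ] E :=
  (ContinuousLinearMap.compL ℝ E (E →L[ℝ] ℝ) E (S q)).comp (christoffelForm G q)

theorem christoffel_apply (G : E → E →L[ℝ] E →L[ℝ] ℝ) (S : E → (E →L[ℝ] ℝ) →L[ℝ] E) (q u v : E) :
    christoffel G S q u v = S q (christoffelForm G q u v) := rfl

theorem contDiffAt_christoffel {G : E → E →L[ℝ] E →L[ℝ] ℝ} {S : E → (E →L[ℝ] ℝ) →L[ℝ] E} {q : E}
    (hG : ContDiffAt ℝ 2 G q) (hS : ContDiffAt ℝ 1 S q) : ContDiffAt ℝ 1 (christoffel G S) q :=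
  (((ContinuousLinearMap.compL ℝ E (E →L[ℝ] ℝ) E).contDiff.contDiffAt.comp q hS).clm_comp
    (contDiffAt_christoffelForm hG))

/-- The transformation rule of the Levi-Civita connection under an isometry. -/
theorem fderiv_fderiv_eq_of_isometric {G : E → E →L[ℝ] E →L[ℝ] ℝ} {S : E → (E →L[ℝ] ℝ) →L[ℝ] E}
    {R : Set E} (hR : IsOpen R) (hG : ∀ q ∈ R, ContDiffAt ℝ 2 G q)
    (hsymm : ∀ q ∈ R, ∀ u v, G q u v = G q v u) (hS : ∀ q ∈ R, ∀ l t, G q (S q l) t = l t)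
    (hnd : ∀ q ∈ R, ∀ a, (∀ t, G q a t = 0) → a = 0) {F : E → E} (hF : ContDiff ℝ 2 F)
    (hFR : ∀ q ∈ R, F q ∈ R) (hsurj : ∀ q, Function.Surjective (fderiv ℝ F q))
    (hiso : ∀ q ∈ R, ∀ u v, G (F q) (fderiv ℝ F q u) (fderiv ℝ F q v) = G q u v) {q : E}
    (hq : q ∈ R) (u v : E) :
    fderiv ℝ (fderiv ℝ F) q u v = fderiv ℝ F q (christoffel G S q u v) -
      christoffel G S (F q) (fderiv ℝ F q u) (fderiv ℝ F q v) := by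
  have dF : ∀ q, HasFDerivAt F (fderiv ℝ F q) q := fun q =>
    (hF.differentiable (by norm_num) q).hasFDerivAt
  have dF2 : HasFDerivAt (fderiv ℝ F) (fderiv ℝ (fderiv ℝ F) q) q :=
    ((hF.fderiv_right (m := 1) (by norm_num)).differentiable (by norm_num) q).hasFDerivAt
  have dG : ∀ q ∈ R, HasFDerivAt G (fderiv ℝ G q) q := fun q hq =>
    ((hG q hq).differentiableAt (by norm_num)).hasFDerivAt
  have sym : ∀ u v, fderiv ℝ (fderiv ℝ F) q u v = fderiv ℝ (fderiv ℝ F) q v u := fun u v =>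
    second_derivative_symmetric dF dF2 u v
  have key : ∀ t u v, fderiv ℝ G (F q) (fderiv ℝ F q t) (fderiv ℝ F q u) (fderiv ℝ F q v) +
      G (F q) (fderiv ℝ (fderiv ℝ F) q t u) (fderiv ℝ F q v) +
      G (F q) (fderiv ℝ F q u) (fderiv ℝ (fderiv ℝ F) q t v) = fderiv ℝ G q t u v := by
    intro t u v
    have h1 := (((dG _ (hFR q hq)).comp q (dF q)).clm_apply
      (dF2.clm_apply (hasFDerivAt_const u q))).clm_apply (dF2.clm_apply (hasFDerivAt_const v q))
    have h2 := ((dG q hq).clm_apply (hasFDerivAt_const u q)).clm_apply (hasFDerivAt_const v q)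
    have h3 := h2.congr_of_eventuallyEq (f₁ := fun q => G (F q) (fderiv ℝ F q u) (fderiv ℝ F q v))
      (Filter.eventually_of_mem (hR.mem_nhds hq) fun q hq => hiso q hq u v)
    have := DFunLike.congr_fun (h1.unique h3) t
    simp at this
    linear_combination this
  have main : ∀ t, G (F q) (fderiv ℝ (fderiv ℝ F) q u v - (fderiv ℝ F q (christoffel G S q u v) -
      christoffel G S (F q) (fderiv ℝ F q u) (fderiv ℝ F q v))) (fderiv ℝ F q t) = 0 := by
    intro t
    simp only [map_sub, sub_apply]
    rw [hiso q hq, christoffel_apply, christoffel_apply, hS _ hq, hS _ (hFR q hq),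
      christoffelForm_apply, christoffelForm_apply]
    have k1 := key u v t
    have k2 := key v u t
    have k3 := key t u v
    rw [sym v u] at k2
    rw [sym t u, sym t v, hsymm _ (hFR q hq) (fderiv ℝ (fderiv ℝ F) q u t)] at k3
    linear_combination (k1 + k2 - k3) / 2
  refine sub_eq_zero.1 (hnd _ (hFR q hq) _ fun t => ?_)
  obtain ⟨t, rfl⟩ := hsurj q t
  exact main t

end LeviCivita

section Metric

set_option maxSynthPendingDepth 3

open heisSmooth

variable {b c d f : ℝ}

/-- The coframe dual to the frame `𝒳, X, Z` at regular points. -/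
def coframe₀ (c d : ℝ) (q : Heis) : Heis →L[ℝ] ℝ := (c * q.1 + d * q.2.1)⁻¹ • formY
def coframe₁ (b c d : ℝ) (q : Heis) : Heis →L[ℝ] ℝ := formX - (b * q.2.1) • coframe₀ c d q
def coframe₂ (b c d f : ℝ) (q : Heis) : Heis →L[ℝ] ℝ :=
  formZ - (subalgLin b c d f q).2.2 • coframe₀ c d q

/-- The metric at regular points, as a field of bilinear forms. -/
def subalgMetric (b c d f : ℝ) (q : Heis) : Heis →L[ℝ] Heis →L[ℝ] ℝ :=
  (coframe₀ c d q).smulRight (coframe₀ c d q) +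
    (coframe₁ b c d q).smulRight (coframe₁ b c d q) +
    (coframe₂ b c d f q).smulRight (coframe₂ b c d f q)

/-- The cometric. -/
def subalgSharp (b c d f : ℝ) (q : Heis) : (Heis →L[ℝ] ℝ) →L[ℝ] Heis :=
  (ContinuousLinearMap.apply ℝ ℝ (subalgLin b c d f q)).smulRight (subalgLin b c d f q) +
    (ContinuousLinearMap.apply ℝ ℝ ((1, 0, 0) : Heis)).smulRight ((1, 0, 0) : Heis) +
    (ContinuousLinearMap.apply ℝ ℝ ((0, 0, 1) : Heis)).smulRight ((0, 0, 1) : Heis)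

theorem subalgMetric_apply (q u v : Heis) : subalgMetric b c d f q u v =
    coframe₀ c d q u * coframe₀ c d q v + coframe₁ b c d q u * coframe₁ b c d q v +
      coframe₂ b c d f q u * coframe₂ b c d f q v := by
  simp [subalgMetric]

theorem subalgSharp_apply (q : Heis) (l : Heis →L[ℝ] ℝ) : subalgSharp b c d f q l =
    l (subalgLin b c d f q) • subalgLin b c d f q + l (1, 0, 0) • ((1, 0, 0) : Heis) +
      l (0, 0, 1) • ((0, 0, 1) : Heis) := by
  simp [subalgSharp]

theorem coframe₀_apply (q u : Heis) : coframe₀ c d q u = u.2.1 / (c * q.1 + d * q.2.1) := by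
  simp [coframe₀, formY_apply]; ring

theorem coframe₁_apply (q u : Heis) :
    coframe₁ b c d q u = u.1 - b * q.2.1 * (u.2.1 / (c * q.1 + d * q.2.1)) := by
  simp [coframe₁, formX_apply, coframe₀_apply]

theorem coframe₂_apply (q u : Heis) : coframe₂ b c d f q u =
    u.2.2 - (subalgLin b c d f q).2.2 * (u.2.1 / (c * q.1 + d * q.2.1)) := by
  simp [coframe₂, formZ_apply, coframe₀_apply]

theorem subalgMetric_self (q u : Heis) :
    subalgMetric b c d f q u u = subalgNormSq b c d f q u := by
  rw [subalgMetric_apply, coframe₀_apply, coframe₁_apply, coframe₂_apply, subalgNormSq]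
  simp only [subalgLin]
  ring

theorem coframe_expand {q : Heis} (hq : c * q.1 + d * q.2.1 ≠ 0) (t : Heis) :
    coframe₀ c d q t • subalgLin b c d f q + coframe₁ b c d q t • ((1, 0, 0) : Heis) +
      coframe₂ b c d f q t • ((0, 0, 1) : Heis) = t := by
  ext
  · simp [coframe₀_apply, coframe₁_apply, subalgLin]; ring
  · simp [coframe₀_apply, subalgLin, hq]
  · simp [coframe₀_apply, coframe₂_apply]; ring

theorem subalgMetric_subalgSharp {q : Heis} (hq : c * q.1 + d * q.2.1 ≠ 0) (l : Heis →L[ℝ] ℝ)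
    (t : Heis) : subalgMetric b c d f q (subalgSharp b c d f q l) t = l t := by
  have h0 : coframe₀ c d q (subalgSharp b c d f q l) = l (subalgLin b c d f q) := by
    rw [subalgSharp_apply, coframe₀_apply]; simp [subalgLin, hq]
  have h1 : coframe₁ b c d q (subalgSharp b c d f q l) = l (1, 0, 0) := by
    rw [subalgSharp_apply, coframe₁_apply]; simp [subalgLin, hq]; ring
  have h2 : coframe₂ b c d f q (subalgSharp b c d f q l) = l (0, 0, 1) := by
    rw [subalgSharp_apply, coframe₂_apply]; simp [subalgLin, hq]; ring
  rw [subalgMetric_apply, h0, h1, h2]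
  conv_rhs => rw [← coframe_expand (b := b) (f := f) hq t]
  simp only [map_add, map_smul, smul_eq_mul]
  ring

theorem eq_zero_of_subalgMetric {q : Heis} (hq : c * q.1 + d * q.2.1 ≠ 0) {a : Heis}
    (h : ∀ t, subalgMetric b c d f q a t = 0) : a = 0 := by
  have := h a
  rw [subalgMetric_apply] at this
  have n0 := mul_self_nonneg (coframe₀ c d q a)
  have n1 := mul_self_nonneg (coframe₁ b c d q a)
  have n2 := mul_self_nonneg (coframe₂ b c d f q a)
  have h0 : coframe₀ c d q a = 0 := mul_self_eq_zero.1 (by linarith)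
  have h1 : coframe₁ b c d q a = 0 := mul_self_eq_zero.1 (by linarith)
  have h2 : coframe₂ b c d f q a = 0 := mul_self_eq_zero.1 (by linarith)
  rw [← coframe_expand (b := b) (f := f) hq a, h0, h1, h2]
  simp

theorem contDiffAt_subalgMetric {q : Heis} (hq : c * q.1 + d * q.2.1 ≠ 0) {n : ℕ∞} :
    ContDiffAt ℝ n (subalgMetric b c d f) q := by
  have e0 : ContDiffAt ℝ n (coframe₀ c d) q :=
    (ContDiffAt.inv (f := fun q : Heis => c * q.1 + d * q.2.1) (by fun_prop) hq).smul
      contDiffAt_const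
  have e1 : ContDiffAt ℝ n (coframe₁ b c d) q :=
    contDiffAt_const.sub (ContDiffAt.smul (f := fun q : Heis => b * q.2.1) (by fun_prop) e0)
  have e2 : ContDiffAt ℝ n (coframe₂ b c d f) q :=
    contDiffAt_const.sub (ContDiffAt.smul
      ((contDiff_subalgLin b c d f).contDiffAt.snd.snd) e0)
  exact ((e0.smulRight e0).add (e1.smulRight e1)).add (e2.smulRight e2)

theorem contDiff_subalgSharp {n : ℕ∞} : ContDiff ℝ n (subalgSharp b c d f) := by
  have e := contDiff_subalgLin b c d f (n := n)
  have e1 : ContDiff ℝ n fun q => ContinuousLinearMap.apply ℝ ℝ (subalgLin b c d f q) :=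
    (ContinuousLinearMap.apply ℝ ℝ : Heis →L[ℝ] (Heis →L[ℝ] ℝ) →L[ℝ] ℝ).contDiff.comp e
  have e2 : ContDiff ℝ n fun q =>
      (ContinuousLinearMap.apply ℝ ℝ (subalgLin b c d f q)).smulRight (subalgLin b c d f q) :=
    ContDiff.smulRight e1 e
  exact (e2.add contDiff_const).add contDiff_const

theorem IsHeisIsometry.subalgMetric_eq {Φ : Heis → Heis}
    (hΦ : IsHeisIsometry (subalgNormal b c d f) (subalgNormal b c d f) Φ) {q : Heis}
    (hq : c * q.1 + d * q.2.1 ≠ 0) (u v : Heis) :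
    subalgMetric b c d f (Φ q) (fderiv ℝ Φ q u) (fderiv ℝ Φ q v) = subalgMetric b c d f q u v := by
  have pol : ∀ q u v, subalgMetric b c d f q u v = (subalgNormSq b c d f q (u + v) -
      subalgNormSq b c d f q u - subalgNormSq b c d f q v) / 2 := fun q u v => by
    simp only [← subalgMetric_self, subalgMetric_apply, (coframe₀ c d q).map_add,
      (coframe₁ b c d q).map_add, (coframe₂ b c d f q).map_add]
    ring
  rw [pol, pol, ← map_add, hΦ.normSq_eq hq, hΦ.normSq_eq hq, hΦ.normSq_eq hq]

/-- An isometry with trivial jet at a point of a regular half space is trivial there. -/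
theorem IsHeisIsometry.eq_self_of_half_space {Φ : Heis → Heis}
    (hΦ : IsHeisIsometry (subalgNormal b c d f) (subalgNormal b c d f) Φ) {σ : ℝ} {q₀ q : Heis}
    (hq₀ : 0 < σ * (c * q₀.1 + d * q₀.2.1)) (h₀ : Φ q₀ = q₀)
    (h₁ : fderiv ℝ Φ q₀ = ContinuousLinearMap.id ℝ Heis)
    (hq : 0 < σ * (c * q.1 + d * q.2.1)) : Φ q = q := by
  have hreg : ∀ q : Heis, 0 < σ * (c * q.1 + d * q.2.1) → c * q.1 + d * q.2.1 ≠ 0 := by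
    intro q hq h
    rw [h, mul_zero] at hq
    exact lt_irrefl _ hq
  have hF : ContDiff ℝ 2 Φ := hΦ.1.smooth.of_le (by norm_cast)
  refine eq_self_along_segment hF (U := {q : Heis | 0 < σ * (c * q.1 + d * q.2.1)})
    (Γ := christoffel (subalgMetric b c d f) (subalgSharp b c d f))
    (isOpen_lt continuous_const (by fun_prop)) ?_ ?_ ?_ hq₀ h₀ h₁ hq
  · intro p hp q hq s t hs ht hst
    simp only [mem_ofPred_eq, Prod.fst_add, Prod.snd_add, Prod.smul_fst, Prod.smul_snd,
      smul_eq_mul] at hp hq ⊢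
    have : 0 < s * (σ * (c * p.1 + d * p.2.1)) + t * (σ * (c * q.1 + d * q.2.1)) := by
      rcases hs.eq_or_lt with rfl | hs'
      · rw [zero_add] at hst
        rw [hst]; linarith
      · have := mul_pos hs' hp
        have := mul_nonneg ht hq.le
        linarith
    linarith
  · intro q hq
    exact contDiffAt_christoffel (contDiffAt_subalgMetric (n := 2) (hreg q hq))
      (contDiff_subalgSharp (n := 1)).contDiffAt
  · intro q hq u v
    exact fderiv_fderiv_eq_of_isometric (isOpen_regular c d)
      (fun q hq => contDiffAt_subalgMetric (n := 2) hq)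
      (fun q hq u v => by rw [subalgMetric_apply, subalgMetric_apply]; ring)
      (fun q hq l t => subalgMetric_subalgSharp hq l t) (fun q hq a => eq_zero_of_subalgMetric hq)
      hF (fun q hq => (hΦ.regular_iff q).not.2 hq) hΦ.1.fderiv_surjective
      (fun q hq u v => hΦ.subalgMetric_eq hq u v) (hreg q hq) u v

end Metric

section Cotangent

set_option maxSynthPendingDepth 3

open heisSmooth

variable {b c d f : ℝ}

/-- The Hamiltonian vector field of the cometric on the cotangent bundle. -/
def subalgHam (b c d f : ℝ) (z : Heis × (Heis →L[ℝ] ℝ)) : Heis × (Heis →L[ℝ] ℝ) :=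
  (subalgSharp b c d f z.1 z.2,
    -(z.2 (subalgLin b c d f z.1) • z.2.comp (fderiv ℝ (subalgLin b c d f) z.1)))

theorem contDiff_subalgHam {n : ℕ∞} : ContDiff ℝ n (subalgHam b c d f) := by
  have e : ContDiff ℝ n fun z : Heis × (Heis →L[ℝ] ℝ) => subalgLin b c d f z.1 :=
    (contDiff_subalgLin b c d f).comp contDiff_fst
  have e' : ContDiff ℝ n fun z : Heis × (Heis →L[ℝ] ℝ) => fderiv ℝ (subalgLin b c d f) z.1 :=
    ((contDiff_subalgLin b c d f (n := n + 1)).fderiv_right (by simp)).comp contDiff_fst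
  exact ((contDiff_subalgSharp.comp contDiff_fst).clm_apply contDiff_snd).prodMk
    ((contDiff_snd.clm_apply e).smul (contDiff_snd.clm_comp e')).neg

/-- The cotangent lift of `Φ`, where `A` is the field of inverses of the differential of `Φ`. -/
def cotangentLift (Φ : Heis → Heis) (A : Heis → Heis →L[ℝ] Heis) (z : Heis × (Heis →L[ℝ] ℝ)) :
    Heis × (Heis →L[ℝ] ℝ) :=
  (Φ z.1, z.2.comp (A z.1))

theorem fderiv_cotangentLift {Φ : Heis → Heis} {A : Heis → Heis →L[ℝ] Heis}
    (hΦ : Differentiable ℝ Φ) (hA : Differentiable ℝ A) (z w : Heis × (Heis →L[ℝ] ℝ)) :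
    fderiv ℝ (cotangentLift Φ A) z w =
      (fderiv ℝ Φ z.1 w.1, z.2.comp (fderiv ℝ A z.1 w.1) + w.2.comp (A z.1)) := by
  have h1 : HasFDerivAt (fun z : Heis × (Heis →L[ℝ] ℝ) => Φ z.1) _ z :=
    (hΦ z.1).hasFDerivAt.comp z hasFDerivAt_fst
  have h2 : HasFDerivAt (fun z : Heis × (Heis →L[ℝ] ℝ) => A z.1) _ z :=
    (hA z.1).hasFDerivAt.comp z hasFDerivAt_fst
  have h3 := h1.prodMk (hasFDerivAt_snd.clm_comp h2)
  have h4 : fderiv ℝ (cotangentLift Φ A) z = _ := h3.fderiv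
  rw [h4]
  refine Prod.ext rfl ?_
  ext <;> simp

theorem fderiv_inverse_comp {Φ : Heis → Heis} {A : Heis → Heis →L[ℝ] Heis}
    (hΦ : ContDiff ℝ 2 Φ) (hA : Differentiable ℝ A)
    (hAΦ : ∀ q v, A q (fderiv ℝ Φ q v) = v) (q u v : Heis) :
    fderiv ℝ A q u (fderiv ℝ Φ q v) = -A q (fderiv ℝ (fderiv ℝ Φ) q u v) := by
  have hd : Differentiable ℝ (fderiv ℝ Φ) :=
    (hΦ.fderiv_right (m := 1) (by norm_num)).differentiable (by simp)
  have h1 : HasFDerivAt (fun q => fderiv ℝ Φ q v) _ q :=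
    (hd q).hasFDerivAt.clm_apply (hasFDerivAt_const v q)
  have h2 := ((hA q).hasFDerivAt.clm_apply h1).fderiv
  have h3 : (fun q => A q (fderiv ℝ Φ q v)) = fun _ => v := funext fun q => hAΦ q v
  rw [h3] at h2
  have h4 := DFunLike.congr_fun h2 u
  simp at h4
  rw [eq_neg_iff_add_eq_zero, add_comm]
  exact h4.symm

theorem IsHeisIsometry.fderiv_cometric (hc : 0 < c) {Φ : Heis → Heis}
    (hΦ : IsHeisIsometry (subalgNormal b c d f) (subalgNormal b c d f) Φ) (P : Heis →L[ℝ] ℝ)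
    (q v : Heis) :
    P (fderiv ℝ (fderiv ℝ Φ) q v (subalgSharp b c d f q (P.comp (fderiv ℝ Φ q)))) +
        P (fderiv ℝ Φ q (subalgLin b c d f q)) *
          P (fderiv ℝ Φ q (fderiv ℝ (subalgLin b c d f) q v)) =
      P (subalgLin b c d f (Φ q)) *
        P (fderiv ℝ (subalgLin b c d f) (Φ q) (fderiv ℝ Φ q v)) := by
  have hF : ContDiff ℝ 2 Φ := hΦ.1.smooth.of_le (by norm_cast)
  have hd : Differentiable ℝ (fderiv ℝ Φ) :=
    (hF.fderiv_right (m := 1) (by norm_num)).differentiable (by simp)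
  have hl : Differentiable ℝ (subalgLin b c d f) :=
    (contDiff_subalgLin b c d f (n := 1)).differentiable (by simp)
  have hk : ∀ e : Heis, HasFDerivAt (fun q => P (fderiv ℝ Φ q e)) _ q := fun e =>
    P.hasFDerivAt.comp q ((hd q).hasFDerivAt.clm_apply (hasFDerivAt_const e q))
  have hm : HasFDerivAt (fun q => P (fderiv ℝ Φ q (subalgLin b c d f q))) _ q :=
    P.hasFDerivAt.comp q ((hd q).hasFDerivAt.clm_apply (hl q).hasFDerivAt)
  have hr : HasFDerivAt (fun q => P (subalgLin b c d f (Φ q))) _ q :=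
    P.hasFDerivAt.comp q ((hl (Φ q)).hasFDerivAt.comp q
      (hF.differentiable (by simp) q).hasFDerivAt)
  have hL := (((hk (1, 0, 0)).mul (hk (1, 0, 0))).add ((hk (0, 0, 1)).mul (hk (0, 0, 1)))).add
    (hm.mul hm)
  have hR := (hr.mul hr).const_add (P (1, 0, 0) * P (1, 0, 0) + P (0, 0, 1) * P (0, 0, 1))
  have key := hL.unique (hR.congr_of_eventuallyEq (Filter.Eventually.of_forall fun q => by
    have := congrArg P (hΦ.cometric hc q P)
    simp only [map_add, map_smul, smul_eq_mul] at this
    exact this))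
  have key2 := DFunLike.congr_fun key v
  simp at key2
  simp only [subalgSharp_apply, map_add, map_smul, smul_eq_mul, ContinuousLinearMap.comp_apply]
  linear_combination key2 / 2

theorem IsHeisIsometry.cotangentLift_subalgHam (hc : 0 < c) {Φ : Heis → Heis}
    (hΦ : IsHeisIsometry (subalgNormal b c d f) (subalgNormal b c d f) Φ)
    {A : Heis → Heis →L[ℝ] Heis} (hA : Differentiable ℝ A)
    (hAΦ : ∀ q v, A q (fderiv ℝ Φ q v) = v) (hΦA : ∀ q v, fderiv ℝ Φ q (A q v) = v)
    (z : Heis × (Heis →L[ℝ] ℝ)) :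
    fderiv ℝ (cotangentLift Φ A) z (subalgHam b c d f z) =
      subalgHam b c d f (cotangentLift Φ A z) := by
  have hF : ContDiff ℝ 2 Φ := hΦ.1.smooth.of_le (by norm_cast)
  obtain ⟨q, p⟩ := z
  have hp : (p.comp (A q)).comp (fderiv ℝ Φ q) = p :=
    ContinuousLinearMap.ext fun v => congrArg p (hAΦ q v)
  rw [fderiv_cotangentLift (hF.differentiable (by simp)) hA]
  refine Prod.ext ?_ (ContinuousLinearMap.ext fun w => ?_)
  · have := hΦ.cometric hc q (p.comp (A q))
    simp only [ContinuousLinearMap.comp_apply, hAΦ] at this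
    simp only [subalgHam, cotangentLift, subalgSharp_apply, map_add, map_smul,
      ContinuousLinearMap.comp_apply]
    rw [add_assoc, add_comm, this, add_comm, ← add_assoc]
  · have h1 := hΦ.fderiv_cometric hc (p.comp (A q)) q (A q w)
    have h2 := fderiv_inverse_comp hF hA hAΦ q (subalgSharp b c d f q p) (A q w)
    have h3 : fderiv ℝ (fderiv ℝ Φ) q (A q w) (subalgSharp b c d f q p) =
        fderiv ℝ (fderiv ℝ Φ) q (subalgSharp b c d f q p) (A q w) :=
      (hF.contDiffAt.isSymmSndFDerivAt (by simp)).eq _ _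
    rw [hΦA] at h2
    rw [hp, h3, hΦA] at h1
    simp only [ContinuousLinearMap.comp_apply, hAΦ] at h1
    simp [subalgHam, cotangentLift, h2]
    linear_combination -h1

/-- An isometry with trivial jet at the identity is trivial along the one-parameter group
of `X`. -/
theorem IsHeisIsometry.eq_self_on_axis (hc : 0 < c) {Φ : Heis → Heis}
    (hΦ : IsHeisIsometry (subalgNormal b c d f) (subalgNormal b c d f) Φ) (h₀ : Φ 0 = 0)
    (h₁ : fderiv ℝ Φ 0 = ContinuousLinearMap.id ℝ Heis) (t : ℝ) :
    Φ (t, 0, 0) = (t, 0, 0) ∧ fderiv ℝ Φ (t, 0, 0) = ContinuousLinearMap.id ℝ Heis := by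
  obtain ⟨Ψ, hl, hr, hΨ⟩ := hΦ.1.exists_smooth_inv
  have hs := hΦ.1.smooth
  have hdΦ : Differentiable ℝ Φ := hs.differentiable (by simp)
  have hdΨ : Differentiable ℝ Ψ := hΨ.differentiable (by simp)
  have hAs : ContDiff ℝ (⊤ : ℕ∞) fun q => fderiv ℝ Ψ (Φ q) :=
    (hΨ.fderiv_right (m := (⊤ : ℕ∞)) (by simp)).comp hs
  have hAd : Differentiable ℝ fun q => fderiv ℝ Ψ (Φ q) := hAs.differentiable (by simp)
  have hAΦ : ∀ q v, fderiv ℝ Ψ (Φ q) (fderiv ℝ Φ q v) = v := fun q v => by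
    have h := ((hdΨ (Φ q)).hasFDerivAt.comp q (hdΦ q).hasFDerivAt).fderiv
    rw [hl.comp_eq_id, fderiv_id] at h
    exact (DFunLike.congr_fun h v).symm
  have hΦA : ∀ q v, fderiv ℝ Φ q (fderiv ℝ Ψ (Φ q) v) = v := fun q v => by
    obtain ⟨u, rfl⟩ := hΦ.1.fderiv_surjective q v
    rw [hAΦ]
  have hFd := fderiv_cotangentLift hdΦ hAd
  have hlin : ∀ t : ℝ, HasFDerivAt (subalgLin b c d f) (fderiv ℝ (subalgLin b c d f) (t, 0, 0))
      (t, 0, 0) := fun t =>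
    ((contDiff_subalgLin b c d f (n := 1)).differentiable (by simp) _).hasFDerivAt
  have hγ : ∀ t : ℝ, HasDerivAt (fun t : ℝ => (((t, 0, 0) : Heis), formX))
      (subalgHam b c d f ((t, 0, 0), formX)) t := fun t => by
    have e : subalgHam b c d f ((t, 0, 0), formX) = ((1, 0, 0), 0) := by
      simp [subalgHam, subalgSharp_apply, formX_apply, subalgLin]
    rw [e]
    exact ((hasDerivAt_id t).prodMk (hasDerivAt_const t ((0, 0) : ℝ × ℝ))).prodMk
      (hasDerivAt_const t formX)
  have hA0 : fderiv ℝ Ψ (Φ 0) = ContinuousLinearMap.id ℝ Heis :=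
    ContinuousLinearMap.ext fun v => by simpa [h₁] using hAΦ 0 v
  obtain ⟨h2, h3⟩ := eq_self_along_integralCurve
    (F := cotangentLift Φ fun q => fderiv ℝ Ψ (Φ q)) (contDiff_subalgHam (n := 2))
    ((hs.comp contDiff_fst).prodMk (contDiff_snd.clm_comp (hAs.comp contDiff_fst)) |>.of_le
      (by norm_cast)) (hΦ.cotangentLift_subalgHam hc hAd hAΦ hΦA) hγ
    (by
      refine Prod.ext h₀ ?_
      change formX.comp (fderiv ℝ Ψ (Φ 0)) = formX
      rw [hA0, ContinuousLinearMap.comp_id])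
    (by
      refine ContinuousLinearMap.ext fun w => ?_
      rw [hFd]
      refine Prod.ext (DFunLike.congr_fun h₁ w.1) (ContinuousLinearMap.ext fun v => ?_)
      have h4 := fderiv_inverse_comp (hs.of_le (by norm_cast)) hAd hAΦ 0 w.1 v
      have h5 := hΦ.fst_second_fderiv_eq_zero hc h₀ w.1 v
      rw [h₁, hA0] at h4
      change formX (fderiv ℝ (fun q => fderiv ℝ Ψ (Φ q)) 0 w.1 v) + w.2 (fderiv ℝ Ψ (Φ 0) v) = _
      rw [hA0]
      simp at h4
      rw [h4, map_neg, formX_apply, h5]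
      simp) t
  refine ⟨congrArg Prod.fst h2, ContinuousLinearMap.ext fun v => ?_⟩
  have := congrArg Prod.fst (DFunLike.congr_fun h3 (v, 0))
  rwa [hFd] at this

end Cotangent

theorem IsHeisIsometry.eq_id {b c d f : ℝ} (hc : 0 < c) {Φ : Heis → Heis}
    (hΦ : IsHeisIsometry (subalgNormal b c d f) (subalgNormal b c d f) Φ) (h₀ : Φ 0 = 0)
    (h₁ : fderiv ℝ Φ 0 = ContinuousLinearMap.id ℝ Heis) : Φ = id := by
  have half : ∀ (σ : ℝ) (q : Heis), 0 < σ * σ → 0 < σ * (c * q.1 + d * q.2.1) → Φ q = q := by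
    intro σ q hσ hq
    obtain ⟨h2, h3⟩ := hΦ.eq_self_on_axis hc h₀ h₁ σ
    refine hΦ.eq_self_of_half_space (q₀ := (σ, 0, 0)) ?_ h2 h3 hq
    have := mul_pos hc hσ
    simp only [mul_zero, add_zero]
    linarith
  refine Continuous.ext_on (dense_regular hc d) hΦ.1.smooth.continuous continuous_id
    fun q hq => ?_
  rcases lt_or_gt_of_ne (mem_ofPred.1 hq) with h | h
  · exact half (-1) q (by norm_num) (by linarith)
  · exact half 1 q (by norm_num) (by linarith)

theorem IsHeisIsometry.exists_eq_heisLT_comp {b c d f : ℝ} (hc : 0 < c) {Φ : Heis → Heis}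
    (hΦ : IsHeisIsometry (subalgNormal b c d f) (subalgNormal b c d f) Φ) :
    ∃ g ∈ (subalgNormal b c d f).linSingularities, ∃ Φ₀ : Heis → Heis,
      IsHeisIsometry (subalgNormal b c d f) (subalgNormal b c d f) Φ₀ ∧ Φ₀ heisOne = heisOne ∧
        Φ = heisLT g ∘ Φ₀ ∧ ∃ u ε : ℝ, (u = 1 ∨ u = -1) ∧ (ε = 1 ∨ ε = -1) ∧ (d ≠ 0 → ε = 1) ∧
          (f ≠ 0 → ε = u) ∧
          ∀ v : Heis, fderiv ℝ Φ₀ heisOne v = (u * v.1, u⁻¹ * ε * v.2.1, ε * v.2.2) := by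
  have hg := hΦ.map_one_mem hc
  have hΦ₀ := (isHeisIsometry_heisLT (heisInv_mem_linSingularities hg)).comp hΦ
  have h0 : (heisLT (heisInv (Φ 0)) ∘ Φ) 0 = 0 := by
    refine Prod.ext ?_ (Prod.ext ?_ ?_) <;> simp [heisLT, heisMul, heisInv]
  obtain ⟨u, ε, hu, hε, hd, hf, hD⟩ := hΦ₀.jet_of_map_one hc h0
  rw [sq, mul_self_eq_one_iff] at hu hε
  refine ⟨Φ 0, hg, _, hΦ₀, h0, funext fun p => (heisLT_heisInv (Φ 0) (Φ p)).symm, u, ε,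
    hu, hε, hd, hf, fun v => (hD v).trans ?_⟩
  rcases hu with rfl | rfl <;> norm_num

theorem IsHeisIsometry.iff_eq_heisLT {b c d f : ℝ} (hc : 0 < c) (hd : d ≠ 0) (hf : f ≠ 0)
    {Φ : Heis → Heis} : IsHeisIsometry (subalgNormal b c d f) (subalgNormal b c d f) Φ ↔
      ∃ g ∈ (subalgNormal b c d f).linSingularities, Φ = heisLT g := by
  refine ⟨fun hΦ => ?_, ?_⟩
  · obtain ⟨g, hg, Φ₀, hΦ₀, h0, rfl, u, ε, -, -, hε, hu, hD⟩ := hΦ.exists_eq_heisLT_comp hc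
    obtain rfl := hε hd
    obtain rfl := hu hf
    refine ⟨g, hg, ?_⟩
    rw [hΦ₀.eq_id hc h0 (ContinuousLinearMap.ext fun v => (hD v).trans (by simp)),
      Function.comp_id]
  · rintro ⟨g, hg, rfl⟩
    exact isHeisIsometry_heisLT hg

theorem linSingularities_eq_singleton {b c d f : ℝ} (hb : b ≠ 0) (hc : 0 < c) (hd : d ≠ 0) :
    (subalgNormal b c d f).linSingularities = {heisOne} := by
  ext ⟨x, y, z⟩
  rw [mem_linSingularities, mem_singleton_iff, heisOne]
  constructor
  · rintro ⟨h1, h2, h3⟩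
    obtain rfl : y = 0 := by simpa [hb] using h1
    obtain rfl : x = 0 := by simpa [hc.ne'] using h2
    obtain rfl : z = 0 := by simpa [hd] using h3
    rfl
  · rintro ⟨⟩
    simp

theorem heisLT_one : heisLT heisOne = id :=
  funext fun p => by simp [heisLT, heisMul, heisOne]

/-- The group of isometries of the normalized subalgebra-case ARS on
the Heisenberg group, according to the values of `d` and `f`; in particular, when
`b`, `d` and `f` are all nonzero, it is reduced to the identity. The linear maps
`P_{ε,ε'} = diag(ε, ε⁻¹ε', ε')` appear as the differentials at the identity of the
identity-fixing isometries. -/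
theorem heis_subalgebra_isometry_group (b c d f : ℝ) (hc : 0 < c) (hd : 0 ≤ d) (hf : 0 ≤ f)
    (S : HeisARS) (hSdef : S = subalgNormal b c d f) (hS : S.IsARS) :
    (d ≠ 0 → f ≠ 0 → ∀ Φ : Heis → Heis,
      IsHeisIsometry S S Φ ↔ ∃ g ∈ S.linSingularities, Φ = heisLT g) ∧
    (d ≠ 0 → f = 0 → ∀ Φ : Heis → Heis,
      IsHeisIsometry S S Φ ↔ ∃ g ∈ S.linSingularities, ∃ ε : ℝ, (ε = 1 ∨ ε = -1) ∧
        ∃ Φ₀ : Heis → Heis, IsHeisIsometry S S Φ₀ ∧ Φ₀ heisOne = heisOne ∧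
          (∀ v : Heis, fderiv ℝ Φ₀ heisOne v = (ε * v.1, ε⁻¹ * 1 * v.2.1, 1 * v.2.2)) ∧
          Φ = heisLT g ∘ Φ₀) ∧
    (d = 0 → f ≠ 0 → ∀ Φ : Heis → Heis,
      IsHeisIsometry S S Φ ↔ ∃ g ∈ S.linSingularities, ∃ ε : ℝ, (ε = 1 ∨ ε = -1) ∧
        ∃ Φ₀ : Heis → Heis, IsHeisIsometry S S Φ₀ ∧ Φ₀ heisOne = heisOne ∧
          (∀ v : Heis, fderiv ℝ Φ₀ heisOne v = (ε * v.1, ε⁻¹ * ε * v.2.1, ε * v.2.2)) ∧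
          Φ = heisLT g ∘ Φ₀) ∧
    (d = 0 → f = 0 → ∀ Φ : Heis → Heis,
      IsHeisIsometry S S Φ ↔ ∃ g ∈ S.linSingularities, ∃ ε ε' : ℝ,
        (ε = 1 ∨ ε = -1) ∧ (ε' = 1 ∨ ε' = -1) ∧
        ∃ Φ₀ : Heis → Heis, IsHeisIsometry S S Φ₀ ∧ Φ₀ heisOne = heisOne ∧
          (∀ v : Heis, fderiv ℝ Φ₀ heisOne v = (ε * v.1, ε⁻¹ * ε' * v.2.1, ε' * v.2.2)) ∧
          Φ = heisLT g ∘ Φ₀) ∧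
    (b ≠ 0 → d ≠ 0 → f ≠ 0 → S.linSingularities = {heisOne} ∧
      ∀ Φ : Heis → Heis, IsHeisIsometry S S Φ ↔ Φ = id) := by
  subst hSdef
  have split : ∀ Φ : Heis → Heis,
      IsHeisIsometry (subalgNormal b c d f) (subalgNormal b c d f) Φ → _ :=
    fun Φ hΦ => hΦ.exists_eq_heisLT_comp hc
  refine ⟨fun h1 h2 Φ => IsHeisIsometry.iff_eq_heisLT hc h1 h2, fun h1 _ Φ => ⟨fun hΦ => ?_, ?_⟩,
    fun _ h2 Φ => ⟨fun hΦ => ?_, ?_⟩, fun _ _ Φ => ⟨fun hΦ => ?_, ?_⟩, fun h0 h1 h2 => ?_⟩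
  · obtain ⟨g, hg, Φ₀, hΦ₀, h0, rfl, u, ε, hu, -, hε, -, hD⟩ := split Φ hΦ
    obtain rfl := hε h1
    exact ⟨g, hg, u, hu, Φ₀, hΦ₀, h0, hD, rfl⟩
  · rintro ⟨g, hg, -, -, Φ₀, hΦ₀, -, -, rfl⟩
    exact (isHeisIsometry_heisLT hg).comp hΦ₀
  · obtain ⟨g, hg, Φ₀, hΦ₀, h0, rfl, u, ε, hu, -, -, hε, hD⟩ := split Φ hΦ
    obtain rfl := hε h2
    exact ⟨g, hg, ε, hu, Φ₀, hΦ₀, h0, hD, rfl⟩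
  · rintro ⟨g, hg, -, -, Φ₀, hΦ₀, -, -, rfl⟩
    exact (isHeisIsometry_heisLT hg).comp hΦ₀
  · obtain ⟨g, hg, Φ₀, hΦ₀, h0, rfl, u, ε, hu, hε, -, -, hD⟩ := split Φ hΦ
    exact ⟨g, hg, u, ε, hu, hε, Φ₀, hΦ₀, h0, hD, rfl⟩
  · rintro ⟨g, hg, -, -, -, -, Φ₀, hΦ₀, -, -, rfl⟩
    exact (isHeisIsometry_heisLT hg).comp hΦ₀
  · have hZ := linSingularities_eq_singleton (f := f) h0 hc h1
    refine ⟨hZ, fun Φ => ?_⟩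
    rw [IsHeisIsometry.iff_eq_heisLT hc h1 h2, hZ]
    simp [heisLT_one]

end
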